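/- With high probability, the graph G_m of the König process with m = ⌈4 n log n⌉ has a unique minimum vertex cover, i.e. there is exactly one vertex cover of G_m of size τ(G_m). -/

import Mathlib

open scoped Classical

noncomputable section

/-- `M` is a matching in the graph `G`: a set of edges of `G` that are pairwise disjoint. -/
def IsMatchingOn {n : ℕ} (G : SimpleGraph (Fin n)) (M : Finset (Sym2 (Fin n))) : Prop :=
  (∀ e ∈ M, e ∈ G.edgeSet) ∧
  ∀ e ∈ M, ∀ f ∈ M, e ≠ f → ∀ v : Fin n, v ∈ e → v ∉ f

/-- ν(G): the maximum size of a matching of `G`. -/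
def matchNum {n : ℕ} (G : SimpleGraph (Fin n)) : ℕ :=
  sSup {k | ∃ M : Finset (Sym2 (Fin n)), IsMatchingOn G M ∧ M.card = k}

/-- `C` is a vertex cover of `G`. -/
def IsVertexCover {n : ℕ} (G : SimpleGraph (Fin n)) (C : Finset (Fin n)) : Prop :=
  ∀ e ∈ G.edgeSet, ∃ v ∈ C, v ∈ e

/-- τ(G): the minimum size of a vertex cover of `G`. -/
def coverNum {n : ℕ} (G : SimpleGraph (Fin n)) : ℕ :=
  sInf {k | ∃ C : Finset (Fin n), IsVertexCover G C ∧ C.card = k}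

/-- `G` is a König graph: ν(G) = τ(G). -/
def IsKonig {n : ℕ} (G : SimpleGraph (Fin n)) : Prop := matchNum G = coverNum G

/-- An ordering `e_1, …, e_N` (0-indexed: `σ 0, …, σ (N-1)`) of the `N = n(n-1)/2` edges of
the complete graph on `Fin n`: an injective function from `Fin N` to non-diagonal elements
of `Sym2 (Fin n)`, hence a bijection onto the edge set of `K_n`. -/
def EdgeOrdering (n : ℕ) : Type :=
  {σ : Fin (n*(n-1)/2) → Sym2 (Fin n) // Function.Injective σ ∧ ∀ i, ¬ (σ i).IsDiag}

/-- The König process: `KonigProc σ m` is the graph `G_m`, where `G_0 = ⊥` and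
`G_{m+1} = G_m + e_{m+1}` if that graph is König, `G_{m+1} = G_m` otherwise. -/
def KonigProc {n : ℕ} (σ : EdgeOrdering n) : ℕ → SimpleGraph (Fin n)
  | 0 => ⊥
  | m+1 =>
    if h : m < n*(n-1)/2 then
      (if IsKonig (KonigProc σ m ⊔ SimpleGraph.fromEdgeSet {σ.1 ⟨m, h⟩})
        then KonigProc σ m ⊔ SimpleGraph.fromEdgeSet {σ.1 ⟨m, h⟩}
        else KonigProc σ m)
    else KonigProc σ m

/-- The probability of an event `A` under the uniformly random edge ordering. -/
def Pr (n : ℕ) (A : EdgeOrdering n → Prop) : ℝ :=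
  (Nat.card {σ : EdgeOrdering n // A σ} : ℝ) / (Nat.card (EdgeOrdering n) : ℝ)

namespace KonigProcess

variable {n : ℕ}

lemma IsVertexCover.exists_choice {G : SimpleGraph (Fin n)} {C : Finset (Fin n)}
    (hC : IsVertexCover G C) :
    ∃ g : Sym2 (Fin n) → Fin n, ∀ e ∈ G.edgeSet, g e ∈ C ∧ g e ∈ e := by
  have h : ∀ e : Sym2 (Fin n), ∃ v, e ∈ G.edgeSet → v ∈ C ∧ v ∈ e := by
    intro e
    by_cases he : e ∈ G.edgeSet
    · obtain ⟨v, hv⟩ := hC e he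
      exact ⟨v, fun _ => hv⟩
    · exact ⟨e.out.1, fun h => absurd h he⟩
  choose g hg using h
  exact ⟨g, hg⟩

lemma IsMatchingOn.card_le_of_cover {G : SimpleGraph (Fin n)} {M : Finset (Sym2 (Fin n))}
    {C : Finset (Fin n)} (hM : IsMatchingOn G M) (hC : IsVertexCover G C) : M.card ≤ C.card := by
  obtain ⟨g, hg'⟩ := IsVertexCover.exists_choice hC
  have hgC := fun e he => (hg' e he).1
  have hg := fun e he => (hg' e he).2
  refine Finset.card_le_card_of_injOn g (fun e he => hgC e (hM.1 e he)) ?_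
  intro e he f hf hef
  by_contra hne
  exact hM.2 e he f hf hne (g e) (hg e (hM.1 e he)) (hef ▸ hg f (hM.1 f hf))

lemma isVertexCover_univ (G : SimpleGraph (Fin n)) : IsVertexCover G Finset.univ := by
  intro e _
  induction e with | _ a b => exact ⟨a, Finset.mem_univ _, by simp⟩

lemma bddAbove_matching (G : SimpleGraph (Fin n)) :
    BddAbove {k | ∃ M : Finset (Sym2 (Fin n)), IsMatchingOn G M ∧ M.card = k} := by
  refine ⟨(Finset.univ : Finset (Fin n)).card, ?_⟩
  rintro k ⟨M, hM, rfl⟩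
  exact IsMatchingOn.card_le_of_cover hM (isVertexCover_univ G)

lemma IsMatchingOn.card_le {G : SimpleGraph (Fin n)} {M : Finset (Sym2 (Fin n))}
    (hM : IsMatchingOn G M) : M.card ≤ matchNum G :=
  le_csSup (bddAbove_matching G) ⟨M, hM, rfl⟩

lemma exists_isMatchingOn (G : SimpleGraph (Fin n)) :
    ∃ M : Finset (Sym2 (Fin n)), IsMatchingOn G M ∧ M.card = matchNum G :=
  Nat.sSup_mem (s := {k | ∃ M : Finset (Sym2 (Fin n)), IsMatchingOn G M ∧ M.card = k})
    ⟨0, ∅, by simp [IsMatchingOn], rfl⟩ (bddAbove_matching G)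

lemma exists_isVertexCover (G : SimpleGraph (Fin n)) :
    ∃ C : Finset (Fin n), IsVertexCover G C ∧ C.card = coverNum G :=
  Nat.sInf_mem (s := {k | ∃ C : Finset (Fin n), IsVertexCover G C ∧ C.card = k})
    ⟨_, Finset.univ, isVertexCover_univ G, rfl⟩

lemma coverNum_le {G : SimpleGraph (Fin n)} {C : Finset (Fin n)} (hC : IsVertexCover G C) :
    coverNum G ≤ C.card :=
  Nat.sInf_le ⟨C, hC, rfl⟩

lemma matchNum_le_coverNum (G : SimpleGraph (Fin n)) : matchNum G ≤ coverNum G := by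
  obtain ⟨M, hM, hMc⟩ := exists_isMatchingOn G
  obtain ⟨C, hC, hCc⟩ := exists_isVertexCover G
  rw [← hMc, ← hCc]
  exact IsMatchingOn.card_le_of_cover hM hC

lemma matchNum_mono {G H : SimpleGraph (Fin n)} (h : G ≤ H) : matchNum G ≤ matchNum H := by
  obtain ⟨M, hM, hMc⟩ := exists_isMatchingOn G
  rw [← hMc]
  exact IsMatchingOn.card_le (G := H)
    ⟨fun e he => SimpleGraph.edgeSet_mono h (hM.1 e he), hM.2⟩

lemma IsVertexCover.anti {G H : SimpleGraph (Fin n)} (h : G ≤ H) {C : Finset (Fin n)}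
    (hC : IsVertexCover H C) : IsVertexCover G C :=
  fun e he => hC e (SimpleGraph.edgeSet_mono h he)

lemma isVertexCover_iff {G : SimpleGraph (Fin n)} {C : Finset (Fin n)} :
    IsVertexCover G C ↔ ∀ a b, G.Adj a b → a ∈ C ∨ b ∈ C := by
  constructor
  · intro h a b hab
    obtain ⟨v, hv, hve⟩ := h s(a, b) hab
    rcases Sym2.mem_iff.1 hve with rfl | rfl
    · exact Or.inl hv
    · exact Or.inr hv
  · intro h e he
    induction e with
    | _ a b =>
      rcases h a b he with h' | h'
      · exact ⟨a, h', by simp⟩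
      · exact ⟨b, h', by simp⟩

/-- The graph `G` together with the edge `e`. -/
abbrev addEdge (G : SimpleGraph (Fin n)) (e : Sym2 (Fin n)) : SimpleGraph (Fin n) :=
  G ⊔ SimpleGraph.fromEdgeSet {e}

lemma le_addEdge (G : SimpleGraph (Fin n)) (e : Sym2 (Fin n)) : G ≤ addEdge G e := le_sup_left

lemma addEdge_adj {G : SimpleGraph (Fin n)} {a b : Fin n} (hab : a ≠ b) :
    (addEdge G s(a, b)).Adj a b := by
  simp [hab]

lemma isVertexCover_addEdge {G : SimpleGraph (Fin n)} {e : Sym2 (Fin n)} {C : Finset (Fin n)}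
    (hC : IsVertexCover G C) {v : Fin n} (hv : v ∈ C) (hve : v ∈ e) :
    IsVertexCover (addEdge G e) C := by
  intro f hf
  simp only [SimpleGraph.edgeSet_sup, SimpleGraph.edgeSet_fromEdgeSet] at hf
  rcases hf with hf | hf
  · exact hC f hf
  · obtain rfl : f = e := hf.1
    exact ⟨v, hv, hve⟩

lemma coverNum_addEdge_le (G : SimpleGraph (Fin n)) (e : Sym2 (Fin n)) :
    coverNum (addEdge G e) ≤ coverNum G + 1 := by
  obtain ⟨C, hC, hCc⟩ := exists_isVertexCover G
  obtain ⟨v, hv⟩ : ∃ v, v ∈ e := by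
    induction e with | _ a b => exact ⟨a, by simp⟩
  have h : IsVertexCover G (insert v C) := fun f hf => by
    obtain ⟨w, hw, hwf⟩ := hC f hf
    exact ⟨w, Finset.mem_insert_of_mem hw, hwf⟩
  calc coverNum (addEdge G e) ≤ (insert v C).card :=
        coverNum_le (isVertexCover_addEdge h (Finset.mem_insert_self _ _) hv)
    _ ≤ C.card + 1 := Finset.card_insert_le _ _
    _ = _ := by rw [hCc]

/-- Minimum vertex covers. -/
def IsMinCover (G : SimpleGraph (Fin n)) (C : Finset (Fin n)) : Prop :=
  IsVertexCover G C ∧ C.card = coverNum G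

lemma isKonig_addEdge_of_cover {G : SimpleGraph (Fin n)} (hG : IsKonig G) {e : Sym2 (Fin n)}
    {C : Finset (Fin n)} (hC : IsMinCover G C) {v : Fin n} (hv : v ∈ C) (hve : v ∈ e) :
    IsKonig (addEdge G e) := by
  have h1 := coverNum_le (isVertexCover_addEdge hC.1 hv hve)
  have h2 := matchNum_mono (le_addEdge G e)
  have h3 := matchNum_le_coverNum (addEdge G e)
  have h4 := hC.2
  unfold IsKonig at *
  omega

lemma isKonig_addEdge_of_lt {G : SimpleGraph (Fin n)} (hG : IsKonig G) {e : Sym2 (Fin n)}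
    (h : matchNum G < matchNum (addEdge G e)) : IsKonig (addEdge G e) := by
  have h1 := coverNum_addEdge_le G e
  have h3 := matchNum_le_coverNum (addEdge G e)
  unfold IsKonig at *
  omega

/-- A system of distinct `G`-neighbours outside `C` for the vertices of `C`. -/
structure Saturates (G : SimpleGraph (Fin n)) (C : Finset (Fin n)) (f : Fin n → Fin n) : Prop where
  adj : ∀ c ∈ C, G.Adj c (f c)
  notMem : ∀ c ∈ C, f c ∉ C
  inj : Set.InjOn f C

lemma IsMinCover.exists_saturates {G : SimpleGraph (Fin n)} (hG : IsKonig G)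
    {C : Finset (Fin n)} (hC : IsMinCover G C) : ∃ f, Saturates G C f := by
  obtain ⟨M, hM, hMc⟩ := exists_isMatchingOn G
  obtain ⟨g, hg'⟩ := IsVertexCover.exists_choice hC.1
  have hgC := fun e he => (hg' e he).1
  have hg := fun e he => (hg' e he).2
  have hinj : Set.InjOn g M := by
    intro e he f hf hef
    by_contra hne
    exact hM.2 e he f hf hne (g e) (hg e (hM.1 e he)) (hef ▸ hg f (hM.1 f hf))
  have himg : M.image g = C := by
    refine Finset.eq_of_subset_of_card_le ?_ ?_
    · intro v hv
      obtain ⟨e, he, rfl⟩ := Finset.mem_image.1 hv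
      exact hgC e (hM.1 e he)
    · rw [Finset.card_image_of_injOn hinj, hMc, hC.2, hG]
  have huniq : ∀ e ∈ M, ∀ f ∈ M, ∀ v, v ∈ e → v ∈ f → e = f := by
    intro e he f hf v hve hvf
    by_contra hne
    exact hM.2 e he f hf hne v hve hvf
  have hex : ∀ c, ∃ w, c ∈ C → s(c, w) ∈ M ∧ g s(c, w) = c := by
    intro c
    by_cases hc : c ∉ C
    · exact ⟨c, fun h => absurd h hc⟩
    rw [not_not] at hc
    rw [← himg] at hc
    obtain ⟨e, he, rfl⟩ := Finset.mem_image.1 hc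
    obtain ⟨w, hw⟩ := hg e (hM.1 e he)
    exact ⟨w, fun _ => ⟨hw ▸ he, by rw [← hw]⟩⟩
  choose f hf using hex
  have hfM := fun c hc => (hf c hc).1
  have hfg := fun c hc => (hf c hc).2
  refine ⟨f, fun c hc => hM.1 _ (hfM c hc), ?_, ?_⟩
  · intro c hc hfc
    have h1 := huniq _ (hfM c hc) _ (hfM _ hfc) (f c) (by simp) (by simp)
    have h2 : c = f c := by
      rw [← hfg _ hfc, ← h1, hfg c hc]
    have h3 : G.Adj c (f c) := hM.1 _ (hfM c hc)
    exact h3.ne h2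
  · intro c hc d hd hcd
    have h1 := huniq _ (hfM c hc) _ (hfM d hd) (f c) (by simp) (by simp [hcd])
    rw [← hfg c hc, h1, hfg d hd]

lemma Saturates.card_le_matchNum {G : SimpleGraph (Fin n)} {C : Finset (Fin n)}
    {f : Fin n → Fin n} (hf : Saturates G C f) : C.card ≤ matchNum G := by
  have hinj : Set.InjOn (fun c => s(c, f c)) C := by
    intro c hc d hd hcd
    rcases Sym2.eq_iff.1 hcd with h | h
    · exact h.1
    · exact absurd (h.2 ▸ hd) (fun h' => hf.notMem c hc (h.2.symm ▸ h'))
  have hM : IsMatchingOn G (C.image fun c => s(c, f c)) := by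
    refine ⟨?_, ?_⟩
    · intro e he
      obtain ⟨c, hc, rfl⟩ := Finset.mem_image.1 he
      exact hf.adj c hc
    · intro e he e' he' hne v hv hv'
      obtain ⟨c, hc, rfl⟩ := Finset.mem_image.1 he
      obtain ⟨d, hd, rfl⟩ := Finset.mem_image.1 he'
      have hcd : c ≠ d := fun h => hne (by rw [h])
      rcases Sym2.mem_iff.1 hv with rfl | rfl <;> rcases Sym2.mem_iff.1 hv' with h | h
      · exact hcd h
      · exact hf.notMem d hd (h ▸ hc)
      · exact hf.notMem c hc (h ▸ hd)
      · exact hcd (hf.inj hc hd h)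
  have := IsMatchingOn.card_le hM
  rwa [Finset.card_image_of_injOn hinj] at this

/-- Two distinct vertices missed by a saturating system are joined by an augmenting pair. -/
lemma Saturates.lt_matchNum_addEdge {G : SimpleGraph (Fin n)} {C : Finset (Fin n)}
    {f : Fin n → Fin n} (hf : Saturates G C f) {x u : Fin n} (hxu : x ≠ u)
    (hx : x ∉ C) (hu : u ∉ C) (hxf : ∀ c ∈ C, f c ≠ x) (huf : ∀ c ∈ C, f c ≠ u) :
    C.card < matchNum (addEdge G s(x, u)) := by
  have h : Saturates (addEdge G s(x, u)) (insert x C) (Function.update f x u) := by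
    have hne : ∀ c ∈ C, c ≠ x := fun c hc h => hx (h ▸ hc)
    refine ⟨?_, ?_, ?_⟩
    · intro c hc
      rcases Finset.mem_insert.1 hc with rfl | hc
      · rw [Function.update_self]
        exact addEdge_adj hxu
      · rw [Function.update_of_ne (hne c hc)]
        exact le_addEdge _ _ (hf.adj c hc)
    · intro c hc
      rcases Finset.mem_insert.1 hc with rfl | hc
      · simp [hxu.symm, hu]
      · rw [Function.update_of_ne (hne c hc)]
        simp [hxf c hc, hf.notMem c hc]
    · intro c hc d hd hcd
      rcases Finset.mem_insert.1 (Finset.mem_coe.1 hc) with rfl | hcC <;>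
        rcases Finset.mem_insert.1 (Finset.mem_coe.1 hd) with rfl | hdC
      · rfl
      · rw [Function.update_self, Function.update_of_ne (hne d hdC)] at hcd
        exact absurd hcd.symm (huf d hdC)
      · rw [Function.update_self, Function.update_of_ne (hne c hcC)] at hcd
        exact absurd hcd (huf c hcC)
      · rw [Function.update_of_ne (hne d hdC), Function.update_of_ne (hne c hcC)] at hcd
        exact hf.inj hcC hdC hcd
  have := h.card_le_matchNum
  rw [Finset.card_insert_of_notMem hx] at this
  omega

/-- The vertices missed by a saturating system. -/
def missed (C : Finset (Fin n)) (f : Fin n → Fin n) : Finset (Fin n) :=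
  Finset.univ \ (C ∪ C.image f)

lemma mem_missed {C : Finset (Fin n)} {f : Fin n → Fin n} {x : Fin n} :
    x ∈ missed C f ↔ x ∉ C ∧ ∀ c ∈ C, f c ≠ x := by
  simp [missed]

lemma Saturates.card_missed {G : SimpleGraph (Fin n)} {C : Finset (Fin n)}
    {f : Fin n → Fin n} (hf : Saturates G C f) : (missed C f).card + 2 * C.card = n := by
  have h1 : Disjoint C (C.image f) := by
    rw [Finset.disjoint_right]
    intro x hx
    obtain ⟨c, hc, rfl⟩ := Finset.mem_image.1 hx
    exact hf.notMem c hc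
  have h2 : (C ∪ C.image f).card = 2 * C.card := by
    rw [Finset.card_union_of_disjoint h1, Finset.card_image_of_injOn hf.inj]; ring
  have h3 := Finset.card_sdiff_add_card_eq_card (Finset.subset_univ (C ∪ C.image f))
  rw [h2] at h3
  simpa [missed] using h3

/-- A set `X` containing all missed vertices, each of whose members can be exchanged for a missed
vertex by re-matching, and whose neighbourhood is matched into `X`. -/
lemma exists_exchange_set {G : SimpleGraph (Fin n)} {C : Finset (Fin n)}
    {f : Fin n → Fin n} (hf : Saturates G C f) (hC : IsVertexCover G C) :
    ∃ X : Finset (Fin n), missed C f ⊆ X ∧ Disjoint X C ∧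
      (∀ x ∈ X, ∃ u₀ ∈ missed C f, ∃ f', Saturates G C f' ∧ x ∈ missed C f' ∧
        ∀ u ∈ missed C f, u ≠ u₀ → u ∈ missed C f') ∧
      ∃ A ⊆ C, (∀ x ∈ X, ∀ w, G.Adj x w → w ∈ A) ∧
        A.card + (missed C f).card ≤ X.card := by
  let good : Finset (Fin n) → Prop := fun X => missed C f ⊆ X ∧ Disjoint X C ∧
    ∀ x ∈ X, ∃ u₀ ∈ missed C f, ∃ f', Saturates G C f' ∧ x ∈ missed C f' ∧
      (∀ u ∈ missed C f, u ≠ u₀ → u ∈ missed C f') ∧ (∀ c ∈ C, f c ∉ X → f' c = f c) ∧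
      (x ∈ missed C f → x = u₀)
  have hU : good (missed C f) := by
    refine ⟨subset_rfl, ?_, ?_⟩
    · rw [Finset.disjoint_left]
      exact fun x hx => (mem_missed.1 hx).1
    · exact fun x hx => ⟨x, hx, f, hf, hx, fun u hu _ => hu, fun _ _ _ => rfl, fun _ => rfl⟩
  obtain ⟨X, hX, hmax⟩ := (Finset.univ.filter good).exists_max_image Finset.card
    ⟨missed C f, by simpa using hU⟩
  simp only [Finset.mem_filter, Finset.mem_univ, true_and] at hX hmax
  obtain ⟨hUX, hXC, hex⟩ := hX
  have hclosed : ∀ x ∈ X, ∀ w, G.Adj x w → w ∈ C ∧ f w ∈ X := by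
    intro x hx w hxw
    have hwC : w ∈ C := by
      rcases isVertexCover_iff.1 hC x w hxw with h | h
      · exact absurd h (Finset.disjoint_left.1 hXC hx)
      · exact h
    refine ⟨hwC, ?_⟩
    by_contra hfw
    obtain ⟨u₀, hu₀, f', hf', hxm, hum, hsame, heq⟩ := hex x hx
    have hf'w : f' w = f w := hsame w hwC hfw
    have hnew : good (insert (f w) X) := by
      refine ⟨hUX.trans (Finset.subset_insert _ _), ?_, ?_⟩
      · rw [Finset.disjoint_insert_left]
        exact ⟨hf.notMem w hwC, hXC⟩
      · intro y hy
        rcases Finset.mem_insert.1 hy with rfl | hy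
        · refine ⟨u₀, hu₀, Function.update f' w x, ⟨?_, ?_, ?_⟩, ?_, ?_, ?_,
            fun h => absurd rfl ((mem_missed.1 h).2 w hwC)⟩
          · intro c hc
            by_cases hcw : c = w
            · subst hcw; simpa using hxw.symm
            · rw [Function.update_of_ne hcw]; exact hf'.adj c hc
          · intro c hc
            by_cases hcw : c = w
            · subst hcw; simpa using (mem_missed.1 hxm).1
            · rw [Function.update_of_ne hcw]; exact hf'.notMem c hc
          · intro c hc d hd hcd
            by_cases hcw : c = w <;> by_cases hdw : d = w
            · rw [hcw, hdw]
            · rw [hcw, Function.update_self, Function.update_of_ne hdw] at hcd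
              exact absurd hcd.symm ((mem_missed.1 hxm).2 d hd)
            · rw [hdw, Function.update_self, Function.update_of_ne hcw] at hcd
              exact absurd hcd ((mem_missed.1 hxm).2 c hc)
            · rw [Function.update_of_ne hdw, Function.update_of_ne hcw] at hcd
              exact hf'.inj hc hd hcd
          · refine mem_missed.2 ⟨hf.notMem w hwC, ?_⟩
            intro c hc
            by_cases hcw : c = w
            · subst hcw
              rw [Function.update_self]
              exact fun h => hfw (h ▸ hx)
            · rw [Function.update_of_ne hcw, ← hf'w]
              exact fun h => hcw (hf'.inj hc hwC h)
          · intro u hu hne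
            have hu' := mem_missed.1 (hum u hu hne)
            refine mem_missed.2 ⟨hu'.1, ?_⟩
            intro c hc
            by_cases hcw : c = w
            · rw [hcw, Function.update_self]
              rintro rfl
              exact hne (heq hu)
            · rw [Function.update_of_ne hcw]; exact hu'.2 c hc
          · intro c hc hcX
            have hcw : c ≠ w := fun h => hcX (by rw [h]; exact Finset.mem_insert_self _ _)
            rw [Function.update_of_ne hcw]
            exact hsame c hc fun h => hcX (Finset.mem_insert_of_mem h)
        · obtain ⟨u₀, hu₀, f', hf', hxm, hum, hsame, heq⟩ := hex y hy
          exact ⟨u₀, hu₀, f', hf', hxm, hum, fun c hc hcX =>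
            hsame c hc fun h => hcX (Finset.mem_insert_of_mem h), heq⟩
    have := hmax _ hnew
    rw [Finset.card_insert_of_notMem hfw] at this
    omega
  refine ⟨X, hUX, hXC, ?_, C.filter fun w => f w ∈ X, Finset.filter_subset _ _, ?_, ?_⟩
  · intro x hx
    obtain ⟨u₀, hu₀, f', hf', hxm, hum, -, -⟩ := hex x hx
    exact ⟨u₀, hu₀, f', hf', hxm, hum⟩
  · intro x hx w hxw
    exact Finset.mem_filter.2 (hclosed x hx w hxw)
  · have h1 : ((C.filter fun w => f w ∈ X).image f).card = (C.filter fun w => f w ∈ X).card :=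
      Finset.card_image_of_injOn (hf.inj.mono (Finset.coe_subset.2 (Finset.filter_subset _ _)))
    rw [← h1, ← Finset.card_union_of_disjoint]
    · refine Finset.card_le_card ?_
      intro y hy
      rcases Finset.mem_union.1 hy with hy | hy
      · obtain ⟨w, hw, rfl⟩ := Finset.mem_image.1 hy
        exact (Finset.mem_filter.1 hw).2
      · exact hUX hy
    · rw [Finset.disjoint_left]
      intro y hy hy'
      obtain ⟨w, hw, rfl⟩ := Finset.mem_image.1 hy
      exact (mem_missed.1 hy').2 w (Finset.mem_filter.1 hw).1 rfl

/-- The number of edges of the complete graph on `n` vertices. -/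
abbrev numPairs (n : ℕ) : ℕ := n * (n - 1) / 2

instance : Fintype (EdgeOrdering n) :=
  inferInstanceAs (Fintype {σ : Fin (n*(n-1)/2) → Sym2 (Fin n) //
    Function.Injective σ ∧ ∀ i, ¬ (σ i).IsDiag})

lemma card_nonDiag : Fintype.card {e : Sym2 (Fin n) // ¬ e.IsDiag} = numPairs n := by
  rw [Sym2.card_subtype_not_diag, Fintype.card_fin, Nat.choose_two_right]

instance : Nonempty (EdgeOrdering n) := by
  have e : Fin (numPairs n) ≃ {e : Sym2 (Fin n) // ¬ e.IsDiag} :=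
    Fintype.equivOfCardEq (by rw [card_nonDiag, Fintype.card_fin])
  exact ⟨⟨fun i => (e i).1, fun i j h => e.injective (Subtype.ext h), fun i => (e i).2⟩⟩

lemma exists_apply_eq (σ : EdgeOrdering n) {e : Sym2 (Fin n)} (he : ¬ e.IsDiag) :
    ∃ j, σ.1 j = e := by
  let g : Fin (numPairs n) → {e : Sym2 (Fin n) // ¬ e.IsDiag} := fun i => ⟨σ.1 i, σ.2.2 i⟩
  have hg : Function.Injective g := fun i j h => σ.2.1 (congrArg Subtype.val h)
  have hb := (Fintype.bijective_iff_injective_and_card g).2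
    ⟨hg, by rw [card_nonDiag, Fintype.card_fin]⟩
  obtain ⟨j, hj⟩ := hb.2 ⟨e, he⟩
  exact ⟨j, congrArg Subtype.val hj⟩

/-- Exchange two positions of an edge ordering. -/
def swapAt (σ : EdgeOrdering n) (i j : Fin (numPairs n)) : EdgeOrdering n :=
  ⟨σ.1 ∘ Equiv.swap i j, σ.2.1.comp (Equiv.swap i j).injective, fun _ => σ.2.2 _⟩

lemma swapAt_apply (σ : EdgeOrdering n) (i j l : Fin (numPairs n)) :
    (swapAt σ i j).1 l = σ.1 (Equiv.swap i j l) := rfl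

lemma swapAt_of_lt (σ : EdgeOrdering n) {i j l : Fin (numPairs n)} (hij : i ≤ j) (hl : l < i) :
    (swapAt σ i j).1 l = σ.1 l := by
  rw [swapAt_apply, Equiv.swap_apply_of_ne_of_ne hl.ne (hl.trans_le hij).ne]

lemma swapAt_swapAt (σ : EdgeOrdering n) (i j : Fin (numPairs n)) :
    swapAt (swapAt σ i j) i j = σ := by
  apply Subtype.ext
  funext l
  simp [swapAt_apply]

lemma sum_swapAt (Φ : EdgeOrdering n → ℝ) (i j : Fin (numPairs n)) :
    ∑ σ, Φ (swapAt σ i j) = ∑ σ, Φ σ :=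
  Equiv.sum_comp (Function.Involutive.toPerm (fun σ => swapAt σ i j)
    (fun σ => swapAt_swapAt σ i j)) Φ

/-- One step of the process. -/
def step (G : SimpleGraph (Fin n)) (e : Sym2 (Fin n)) : SimpleGraph (Fin n) :=
  if IsKonig (addEdge G e) then addEdge G e else G

lemma konigProc_succ (σ : EdgeOrdering n) (i : Fin (numPairs n)) :
    KonigProc σ (i + 1) = step (KonigProc σ i) (σ.1 i) := by
  rw [KonigProc, dif_pos i.2]
  rfl

lemma konigProc_congr {σ σ' : EdgeOrdering n} {m : ℕ}
    (h : ∀ l : Fin (numPairs n), (l : ℕ) < m → σ.1 l = σ'.1 l) :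
    KonigProc σ m = KonigProc σ' m := by
  induction m with
  | zero => rfl
  | succ m ih =>
    have ih := ih fun l hl => h l (hl.trans (Nat.lt_succ_self m))
    by_cases hm : m < numPairs n
    · have h1 := konigProc_succ σ ⟨m, hm⟩
      have h2 := konigProc_succ σ' ⟨m, hm⟩
      simp only at h1 h2
      rw [h1, h2, ih, h ⟨m, hm⟩ (Nat.lt_succ_self m)]
    · rw [KonigProc, KonigProc, dif_neg hm, dif_neg hm, ih]

lemma konigProc_swapAt (σ : EdgeOrdering n) {i j : Fin (numPairs n)} (hij : i ≤ j) {m : ℕ}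
    (hm : m ≤ i) : KonigProc (swapAt σ i j) m = KonigProc σ m :=
  konigProc_congr fun _ hl => swapAt_of_lt σ hij (Fin.lt_def.2 (hl.trans_le hm))

lemma konigProc_swapAt_succ (σ : EdgeOrdering n) {i j : Fin (numPairs n)} (hij : i ≤ j) :
    KonigProc (swapAt σ i j) (i + 1) = step (KonigProc σ i) (σ.1 j) := by
  rw [konigProc_succ, konigProc_swapAt σ hij le_rfl, swapAt_apply, Equiv.swap_apply_left]

lemma le_step (G : SimpleGraph (Fin n)) (e : Sym2 (Fin n)) : G ≤ step G e := by
  unfold step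
  split_ifs
  · exact le_addEdge G e
  · exact le_rfl

lemma isKonig_step {G : SimpleGraph (Fin n)} (hG : IsKonig G) (e : Sym2 (Fin n)) :
    IsKonig (step G e) := by
  unfold step
  split_ifs with h
  · exact h
  · exact hG

lemma step_eq_of_cover {G : SimpleGraph (Fin n)} (hG : IsKonig G) {e : Sym2 (Fin n)}
    {C : Finset (Fin n)} (hC : IsMinCover G C) {v : Fin n} (hv : v ∈ C) (hve : v ∈ e) :
    step G e = addEdge G e :=
  if_pos (isKonig_addEdge_of_cover hG hC hv hve)

lemma matchNum_lt_step {G : SimpleGraph (Fin n)} (hG : IsKonig G) {e : Sym2 (Fin n)}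
    (h : matchNum G < matchNum (addEdge G e)) : matchNum G < matchNum (step G e) := by
  rwa [step, if_pos (isKonig_addEdge_of_lt hG h)]

lemma konigProc_le_succ (σ : EdgeOrdering n) (m : ℕ) : KonigProc σ m ≤ KonigProc σ (m + 1) := by
  by_cases hm : m < numPairs n
  · have h1 := konigProc_succ σ ⟨m, hm⟩
    simp only at h1
    rw [h1]
    exact le_step _ _
  · rw [KonigProc, dif_neg hm]

lemma konigProc_mono (σ : EdgeOrdering n) : Monotone (KonigProc σ) :=
  monotone_nat_of_le_succ (konigProc_le_succ σ)

lemma isKonig_konigProc (σ : EdgeOrdering n) (m : ℕ) : IsKonig (KonigProc σ m) := by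
  induction m with
  | zero =>
    have h : coverNum (KonigProc σ 0) ≤ 0 :=
      coverNum_le (C := ∅) (isVertexCover_iff.2 fun a b h => absurd h (by simp [KonigProc]))
    have := matchNum_le_coverNum (KonigProc σ 0)
    unfold IsKonig
    omega
  | succ m ih =>
    by_cases hm : m < numPairs n
    · have h1 := konigProc_succ σ ⟨m, hm⟩
      simp only at h1
      rw [h1]
      exact isKonig_step ih _
    · rwa [KonigProc, dif_neg hm]

lemma pr_eq (A : EdgeOrdering n → Prop) :
    Pr n A = (∑ σ : EdgeOrdering n, if A σ then (1 : ℝ) else 0) / Fintype.card (EdgeOrdering n) := by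
  rw [Pr, Nat.card_eq_fintype_card, Nat.card_eq_fintype_card, Fintype.card_subtype]
  simp

lemma card_edgeOrdering_pos : (0 : ℝ) < Fintype.card (EdgeOrdering n) := by
  exact_mod_cast Fintype.card_pos

lemma pr_le_sum {A : EdgeOrdering n → Prop} {Φ : EdgeOrdering n → ℝ} (h0 : ∀ σ, 0 ≤ Φ σ)
    (hA : ∀ σ, A σ → 1 ≤ Φ σ) : Pr n A ≤ (∑ σ, Φ σ) / Fintype.card (EdgeOrdering n) := by
  rw [pr_eq]
  gcongr with σ
  split_ifs with h
  · exact hA σ h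
  · exact h0 σ

lemma pr_mono {A B : EdgeOrdering n → Prop} (h : ∀ σ, A σ → B σ) : Pr n A ≤ Pr n B := by
  rw [pr_eq B]
  refine pr_le_sum (fun σ => by split_ifs <;> norm_num) fun σ hσ => by rw [if_pos (h σ hσ)]

lemma pr_nonneg (A : EdgeOrdering n → Prop) : 0 ≤ Pr n A := by
  unfold Pr; positivity

lemma pr_or_le (A B : EdgeOrdering n → Prop) : Pr n (fun σ => A σ ∨ B σ) ≤ Pr n A + Pr n B := by
  rw [pr_eq A, pr_eq B, ← add_div, ← Finset.sum_add_distrib]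
  refine pr_le_sum (fun σ => by split_ifs <;> norm_num) fun σ hσ => ?_
  rcases hσ with h | h <;> simp only [h, if_true] <;> split_ifs <;> norm_num

lemma pr_exists_le {ι : Type*} (s : Finset ι) (A : ι → EdgeOrdering n → Prop) :
    Pr n (fun σ => ∃ x ∈ s, A x σ) ≤ ∑ x ∈ s, Pr n (A x) := by
  simp_rw [pr_eq (A _), ← Finset.sum_div]
  rw [Finset.sum_comm]
  refine pr_le_sum (fun σ => Finset.sum_nonneg fun x _ => by split_ifs <;> norm_num) ?_
  rintro σ ⟨x, hx, h⟩
  calc (1 : ℝ) = if A x σ then 1 else 0 := by rw [if_pos h]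
    _ ≤ _ := Finset.single_le_sum (f := fun x => if A x σ then (1 : ℝ) else 0)
      (fun x _ => by split_ifs <;> norm_num) hx

lemma pr_compl (A : EdgeOrdering n → Prop) : Pr n A = 1 - Pr n (fun σ => ¬ A σ) := by
  have h : Pr n A + Pr n (fun σ => ¬ A σ) = 1 := by
    rw [pr_eq, pr_eq, ← add_div, ← Finset.sum_add_distrib, div_eq_one_iff_eq
      card_edgeOrdering_pos.ne']
    refine (Finset.sum_congr rfl (g := fun _ => (1 : ℝ)) fun σ _ => ?_).trans (by simp)
    by_cases h : A σ <;> simp [h]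
  linarith

/-- The unrevealed edges are exchangeable. -/
lemma sum_le_of_swapAt {Φ Ψ : EdgeOrdering n → ℝ} {ρ : ℝ} (i : Fin (numPairs n))
    (h : ∀ σ, ∑ j ∈ Finset.Ici i, Φ (swapAt σ i j) ≤ ((numPairs n : ℝ) - (i : ℕ)) * ρ * Ψ σ) :
    ∑ σ, Φ σ ≤ ρ * ∑ σ, Ψ σ := by
  have hi : (0 : ℝ) < (numPairs n : ℝ) - (i : ℕ) := by
    have : ((i : ℕ) : ℝ) < (numPairs n : ℝ) := by exact_mod_cast i.2
    linarith
  have h1 := Finset.sum_le_sum fun σ (_ : σ ∈ (Finset.univ : Finset (EdgeOrdering n))) => h σ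
  rw [Finset.sum_comm, ← Finset.mul_sum] at h1
  simp_rw [sum_swapAt] at h1
  rw [Finset.sum_const, Fin.card_Ici, nsmul_eq_mul, Nat.cast_sub i.2.le] at h1
  rw [mul_assoc] at h1
  exact le_of_mul_le_mul_left h1 hi

lemma pr_le_of_potential (Φ : ℕ → EdgeOrdering n → ℝ) {a b : ℕ} (hab : a ≤ b)
    (hb : b ≤ numPairs n) {ρ K : ℝ} (hρ : 0 ≤ ρ) (hK : ∀ σ, Φ a σ ≤ K)
    (hstep : ∀ i : Fin (numPairs n), a ≤ i → (i : ℕ) < b → ∀ σ,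
      ∑ j ∈ Finset.Ici i, Φ (i + 1) (swapAt σ i j) ≤ ((numPairs n : ℝ) - (i : ℕ)) * ρ * Φ i σ)
    (h0 : ∀ σ, 0 ≤ Φ b σ) {A : EdgeOrdering n → Prop} (hA : ∀ σ, A σ → 1 ≤ Φ b σ) :
    Pr n A ≤ K * ρ ^ (b - a) := by
  have key : ∀ t, a + t ≤ b → ∑ σ, Φ (a + t) σ ≤ ρ ^ t * ∑ σ, Φ a σ := by
    intro t
    induction t with
    | zero => intro _; simp
    | succ t ih =>
      intro ht
      have hlt : a + t < numPairs n := by omega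
      have h1 := sum_le_of_swapAt ⟨a + t, hlt⟩
        (hstep ⟨a + t, hlt⟩ (Nat.le_add_right _ _) (by simp only; omega))
      have h2 := ih (by omega)
      calc ∑ σ, Φ (a + (t + 1)) σ ≤ ρ * ∑ σ, Φ (a + t) σ := h1
        _ ≤ ρ * (ρ ^ t * ∑ σ, Φ a σ) := by gcongr
        _ = _ := by ring
  have h1 := key (b - a) (by omega)
  rw [Nat.add_sub_cancel' hab] at h1
  refine (pr_le_sum h0 hA).trans ?_
  rw [div_le_iff₀ card_edgeOrdering_pos]
  calc ∑ σ, Φ b σ ≤ ρ ^ (b - a) * ∑ σ, Φ a σ := h1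
    _ ≤ ρ ^ (b - a) * ∑ _σ : EdgeOrdering n, K := by
        gcongr with σ
        exact hK σ
    _ = _ := by rw [Finset.sum_const, Finset.card_univ, nsmul_eq_mul]; ring

/-- The members of `F` revealed before time `i`. -/
def revealed (σ : EdgeOrdering n) (i : ℕ) (F : Finset (Sym2 (Fin n))) :
    Finset (Fin (numPairs n)) :=
  Finset.univ.filter fun l => (l : ℕ) < i ∧ σ.1 l ∈ F

lemma card_le_revealed_add (σ : EdgeOrdering n) (i : Fin (numPairs n))
    {F : Finset (Sym2 (Fin n))} (hF : ∀ e ∈ F, ¬ e.IsDiag) :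
    F.card ≤ (revealed σ i F).card + ((Finset.Ici i).filter fun j => σ.1 j ∈ F).card := by
  have h : F ⊆ (revealed σ i F ∪ (Finset.Ici i).filter fun j => σ.1 j ∈ F).image σ.1 := by
    intro e he
    obtain ⟨j, rfl⟩ := exists_apply_eq σ (hF e he)
    refine Finset.mem_image_of_mem _ ?_
    rcases lt_or_ge j i with hj | hj
    · exact Finset.mem_union_left _ (by simpa [revealed] using ⟨hj, he⟩)
    · exact Finset.mem_union_right _ (by simpa using ⟨hj, he⟩)
  exact (Finset.card_le_card h).trans (Finset.card_image_le.trans (Finset.card_union_le _ _))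

lemma card_revealed_le (σ : EdgeOrdering n) (i : ℕ) (F : Finset (Sym2 (Fin n))) :
    (revealed σ i F).card ≤ i := by
  have h : (revealed σ i F).image Fin.val ⊆ Finset.range i := by
    intro x hx
    obtain ⟨l, hl, rfl⟩ := Finset.mem_image.1 hx
    simpa using (Finset.mem_filter.1 hl).2.1
  have := Finset.card_le_card h
  rwa [Finset.card_image_of_injective _ Fin.val_injective, Finset.card_range] at this

lemma pr_le_of_drift (Φ : ℕ → EdgeOrdering n → ℝ) {a b : ℕ} (hab : a ≤ b)
    (hb : b ≤ numPairs n) {lam K : ℝ} (hl : 0 ≤ lam) (hl1 : lam ≤ 1) (hK0 : 0 ≤ K)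
    (hK : ∀ σ, Φ a σ ≤ K) (h0 : ∀ i σ, 0 ≤ Φ i σ)
    (hmono : ∀ i : Fin (numPairs n), a ≤ i → (i : ℕ) < b → ∀ σ, ∀ j, i ≤ j →
      Φ (i + 1) (swapAt σ i j) ≤ Φ i σ)
    (hdrop : ∀ i : Fin (numPairs n), a ≤ i → (i : ℕ) < b → ∀ σ, Φ i σ ≠ 0 →
      ∃ (F : Finset (Sym2 (Fin n))) (c : ℝ), 0 ≤ c ∧ (∀ e ∈ F, ¬ e.IsDiag) ∧
        (∀ j, i ≤ j → σ.1 j ∈ F → Φ (i + 1) (swapAt σ i j) ≤ (1 - c) * Φ i σ) ∧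
        lam * numPairs n ≤ c * ((F.card : ℝ) - (revealed σ i F).card))
    {A : EdgeOrdering n → Prop} (hA : ∀ σ, A σ → 1 ≤ Φ b σ) :
    Pr n A ≤ K * Real.exp (-(lam * ((b : ℝ) - a))) := by
  have h1 : Pr n A ≤ K * (1 - lam) ^ (b - a) := by
    refine pr_le_of_potential Φ hab hb (by linarith) hK ?_ (h0 b) hA
    intro i hai hib σ
    by_cases hz : Φ i σ = 0
    · rw [hz, mul_zero]
      refine Finset.sum_nonpos fun j hj => ?_
      rw [← hz]
      exact hmono i hai hib σ j (Finset.mem_Ici.1 hj)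
    · obtain ⟨F, c, hc, hF, hdec, hcard⟩ := hdrop i hai hib σ hz
      have hle := card_le_revealed_add σ i hF
      have hbound : ∀ j ∈ Finset.Ici i, Φ (i + 1) (swapAt σ i j) ≤
          Φ i σ - if σ.1 j ∈ F then c * Φ i σ else 0 := by
        intro j hj
        split_ifs with hjF
        · have := hdec j (Finset.mem_Ici.1 hj) hjF
          linarith
        · simpa using hmono i hai hib σ j (Finset.mem_Ici.1 hj)
      refine (Finset.sum_le_sum hbound).trans ?_
      rw [Finset.sum_sub_distrib, Finset.sum_const, Fin.card_Ici, nsmul_eq_mul,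
        Nat.cast_sub i.2.le, ← Finset.sum_filter, Finset.sum_const, nsmul_eq_mul]
      have hle' : (F.card : ℝ) - (revealed σ i F).card ≤
          (((Finset.Ici i).filter fun j => σ.1 j ∈ F).card : ℝ) := by
        rw [sub_le_iff_le_add']
        exact_mod_cast hle
      have h2 : lam * numPairs n ≤
          c * (((Finset.Ici i).filter fun j => σ.1 j ∈ F).card : ℝ) :=
        hcard.trans (mul_le_mul_of_nonneg_left hle' hc)
      have h3 := mul_le_mul_of_nonneg_right h2 (h0 i σ)
      have h4 : 0 ≤ lam * ((i : ℕ) : ℝ) * Φ i σ :=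
        mul_nonneg (mul_nonneg hl (Nat.cast_nonneg _)) (h0 i σ)
      linarith
  refine h1.trans (mul_le_mul_of_nonneg_left ?_ hK0)
  have h2 : 1 - lam ≤ Real.exp (-lam) := by
    have := Real.add_one_le_exp (-lam)
    linarith
  calc (1 - lam) ^ (b - a) ≤ Real.exp (-lam) ^ (b - a) :=
        pow_le_pow_left₀ (by linarith) h2 _
    _ = _ := by rw [← Real.exp_nat_mul, Nat.cast_sub hab]; congr 1; ring

/-- An event that survives each step with conditional probability at most `1 - lam`. -/
lemma pr_le_of_kill (B : ℕ → EdgeOrdering n → Prop) {a b : ℕ} (hab : a ≤ b)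
    (hb : b ≤ numPairs n) {lam : ℝ} (hl : 0 ≤ lam) (hl1 : lam ≤ 1)
    (hmono : ∀ i : Fin (numPairs n), a ≤ i → (i : ℕ) < b → ∀ σ, ∀ j, i ≤ j →
      B (i + 1) (swapAt σ i j) → B i σ)
    (hkill : ∀ i : Fin (numPairs n), a ≤ i → (i : ℕ) < b → ∀ σ, B i σ →
      ∃ F : Finset (Sym2 (Fin n)), (∀ e ∈ F, ¬ e.IsDiag) ∧
        (∀ j, i ≤ j → σ.1 j ∈ F → ¬ B (i + 1) (swapAt σ i j)) ∧
        lam * numPairs n ≤ (F.card : ℝ) - (revealed σ i F).card) :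
    Pr n (B b) ≤ Real.exp (-(lam * ((b : ℝ) - a))) := by
  have := pr_le_of_drift (fun i σ => if B i σ then (1 : ℝ) else 0) hab hb hl hl1 zero_le_one
    (fun σ => by split_ifs <;> norm_num) (fun i σ => by split_ifs <;> norm_num)
    (fun i hai hib σ j hj => by
      by_cases h : B (i + 1) (swapAt σ i j)
      · rw [if_pos h, if_pos (hmono i hai hib σ j hj h)]
      · rw [if_neg h]; split_ifs <;> norm_num)
    (fun i hai hib σ hne => by
      have hB : B i σ := by
        by_contra h
        exact hne (if_neg h)
      obtain ⟨F, hF, hk, hc⟩ := hkill i hai hib σ hB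
      refine ⟨F, 1, zero_le_one, hF, fun j hj hjF => ?_, by simpa using hc⟩
      rw [if_neg (hk j hj hjF)]
      simp)
    (A := B b) (fun σ h => by rw [if_pos h])
  simpa using this

/-- The edges at the vertex `v`, together with the loop. -/
def star (v : Fin n) : Finset (Sym2 (Fin n)) := Finset.univ.filter fun e => v ∈ e

lemma mem_star {v : Fin n} {e : Sym2 (Fin n)} : e ∈ star v ↔ v ∈ e := by simp [star]

/-- Every vertex lies in at most `D` of the edges revealed before time `i`. -/
def DegBound (D : ℝ) (i : ℕ) (σ : EdgeOrdering n) : Prop :=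
  ∀ v, ((revealed σ i (star v)).card : ℝ) ≤ D

lemma revealed_subset_swapAt (σ : EdgeOrdering n) {i j : Fin (numPairs n)} (hij : i ≤ j)
    (F : Finset (Sym2 (Fin n))) : revealed σ i F ⊆ revealed (swapAt σ i j) (i + 1) F := by
  intro l hl
  simp only [revealed, Finset.mem_filter, Finset.mem_univ, true_and] at hl ⊢
  rw [swapAt_of_lt σ hij (Fin.lt_def.2 hl.1)]
  exact ⟨hl.1.trans (Nat.lt_succ_self _), hl.2⟩

lemma revealed_swapAt_subset (σ : EdgeOrdering n) {i j : Fin (numPairs n)} (hij : i ≤ j)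
    (F : Finset (Sym2 (Fin n))) :
    revealed (swapAt σ i j) (i + 1) F ⊆ revealed σ i F ∪ if σ.1 j ∈ F then {i} else ∅ := by
  intro l hl
  simp only [revealed, Finset.mem_filter, Finset.mem_univ, true_and, Finset.mem_union] at hl ⊢
  rcases (Nat.lt_succ_iff.1 hl.1).lt_or_eq with h | h
  · rw [swapAt_of_lt σ hij (Fin.lt_def.2 h)] at hl
    exact Or.inl ⟨h, hl.2⟩
  · obtain rfl : l = i := Fin.ext h
    rw [swapAt_apply, Equiv.swap_apply_left] at hl
    right
    simp [hl.2]

lemma DegBound.of_swapAt {D : ℝ} {σ : EdgeOrdering n} {i j : Fin (numPairs n)} (hij : i ≤ j)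
    (h : DegBound D (i + 1) (swapAt σ i j)) : DegBound D i σ := fun v =>
  le_trans (by exact_mod_cast Finset.card_le_card (revealed_subset_swapAt σ hij (star v))) (h v)

lemma DegBound.anti {D : ℝ} {σ : EdgeOrdering n} {i j : ℕ} (hij : i ≤ j)
    (h : DegBound D j σ) : DegBound D i σ := fun v => by
  refine le_trans ?_ (h v)
  have : revealed σ i (star v) ⊆ revealed σ j (star v) := by
    intro l hl
    simp only [revealed, Finset.mem_filter, Finset.mem_univ, true_and] at hl ⊢
    exact ⟨hl.1.trans_le hij, hl.2⟩
  exact_mod_cast Finset.card_le_card this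

lemma DegBound.card_revealed_le {D : ℝ} {σ : EdgeOrdering n} {i : ℕ} (h : DegBound D i σ)
    {F : Finset (Sym2 (Fin n))} {S : Finset (Fin n)} (hF : ∀ e ∈ F, ∃ v ∈ S, v ∈ e) :
    ((revealed σ i F).card : ℝ) ≤ S.card * D := by
  have hsub : revealed σ i F ⊆ S.biUnion fun v => revealed σ i (star v) := by
    intro l hl
    simp only [revealed, Finset.mem_filter, Finset.mem_univ, true_and, Finset.mem_biUnion,
      mem_star] at hl ⊢
    obtain ⟨v, hv, hve⟩ := hF _ hl.2
    exact ⟨v, hv, hl.1, hve⟩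
  calc ((revealed σ i F).card : ℝ) ≤ ((S.biUnion fun v => revealed σ i (star v)).card : ℝ) := by
        exact_mod_cast Finset.card_le_card hsub
    _ ≤ ∑ v ∈ S, ((revealed σ i (star v)).card : ℝ) := by
        exact_mod_cast Finset.card_biUnion_le
    _ ≤ ∑ _v ∈ S, D := Finset.sum_le_sum fun v _ => h v
    _ = _ := by rw [Finset.sum_const, nsmul_eq_mul]

lemma card_star_le (v : Fin n) : (star v).card ≤ n := by
  have : star v ⊆ Finset.univ.image fun w => s(v, w) := by
    intro e he
    obtain ⟨w, rfl⟩ := mem_star.1 he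
    exact Finset.mem_image_of_mem _ (Finset.mem_univ _)
  simpa using (Finset.card_le_card this).trans Finset.card_image_le

lemma pr_lt_card_revealed_star_le (v : Fin n) {m : ℕ} (hm : m ≤ numPairs n) {θ D : ℝ}
    (hθ : 0 ≤ θ) (hnθ : (n : ℝ) ≤ ((numPairs n : ℝ) - m) * θ) :
    Pr n (fun σ => D < (revealed σ m (star v)).card) ≤ (2 : ℝ) ^ (-D) * (1 + θ) ^ m := by
  have := pr_le_of_potential
    (fun i (σ : EdgeOrdering n) => (2 : ℝ) ^ (revealed σ i (star v)).card * (2 : ℝ) ^ (-D))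
    (Nat.zero_le m) hm (ρ := 1 + θ) (K := (2 : ℝ) ^ (-D)) (by linarith)
    (fun σ => by simp [revealed]) ?_ (fun σ => by positivity)
    (A := fun σ => D < (revealed σ m (star v)).card) ?_
  · simpa using this
  · intro i _ him σ
    set c := (2 : ℝ) ^ (revealed σ i (star v)).card * (2 : ℝ) ^ (-D) with hc
    have hc0 : 0 ≤ c := by positivity
    have hb : ∀ j ∈ Finset.Ici i, (2 : ℝ) ^ (revealed (swapAt σ i j) (i + 1) (star v)).card *
        (2 : ℝ) ^ (-D) ≤ c + if σ.1 j ∈ star v then c else 0 := by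
      intro j hj
      have h1 := Finset.card_le_card
        (revealed_swapAt_subset σ (Finset.mem_Ici.1 hj) (star v))
      have h2 := h1.trans (Finset.card_union_le _ _)
      split_ifs at h2 ⊢ with hs
      · rw [Finset.card_singleton] at h2
        calc _ ≤ (2 : ℝ) ^ ((revealed σ i (star v)).card + 1) * (2 : ℝ) ^ (-D) := by
              gcongr; norm_num
          _ = c + c := by rw [hc]; ring
      · rw [Finset.card_empty, add_zero] at h2
        rw [add_zero, hc]
        gcongr
        norm_num
    refine (Finset.sum_le_sum hb).trans ?_
    rw [Finset.sum_add_distrib, Finset.sum_const, Fin.card_Ici, nsmul_eq_mul,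
      Nat.cast_sub i.2.le, ← Finset.sum_filter, Finset.sum_const, nsmul_eq_mul]
    have h3 : (((Finset.Ici i).filter fun j => σ.1 j ∈ star v).card : ℝ) ≤ n := by
      have : (((Finset.Ici i).filter fun j => σ.1 j ∈ star v).image σ.1) ⊆ star v := by
        intro e he
        obtain ⟨j, hj, rfl⟩ := Finset.mem_image.1 he
        exact (Finset.mem_filter.1 hj).2
      have h := (Finset.card_le_card this).trans (card_star_le v)
      rw [Finset.card_image_of_injective _ σ.2.1] at h
      exact_mod_cast h
    have h4 : ((i : ℕ) : ℝ) ≤ m := by exact_mod_cast him.le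
    have h5 : ((numPairs n : ℝ) - m) * θ ≤ ((numPairs n : ℝ) - (i : ℕ)) * θ := by gcongr
    have h6 := mul_le_mul_of_nonneg_right (h3.trans (hnθ.trans h5)) hc0
    linarith
  · intro σ hσ
    rw [← Real.rpow_natCast, ← Real.rpow_add two_pos]
    exact Real.one_le_rpow one_le_two (by linarith)

/-- The pairs of distinct elements of `U`. -/
def pairsIn (U : Finset (Fin n)) : Finset (Sym2 (Fin n)) := U.offDiag.image Sym2.mk.uncurry

lemma card_pairsIn (U : Finset (Fin n)) : (pairsIn U).card = U.card.choose 2 :=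
  Sym2.card_image_offDiag U

lemma mem_pairsIn {U : Finset (Fin n)} {e : Sym2 (Fin n)} :
    e ∈ pairsIn U ↔ ∃ a b, a ∈ U ∧ b ∈ U ∧ a ≠ b ∧ e = s(a, b) := by
  simp only [pairsIn, Finset.mem_image, Finset.mem_offDiag, Prod.exists]
  constructor
  · rintro ⟨a, b, ⟨h1, h2, h3⟩, rfl⟩
    exact ⟨a, b, h1, h2, h3, rfl⟩
  · rintro ⟨a, b, h1, h2, h3, rfl⟩
    exact ⟨a, b, ⟨h1, h2, h3⟩, rfl⟩

lemma not_isDiag_of_mem_pairsIn {U : Finset (Fin n)} {e : Sym2 (Fin n)} (he : e ∈ pairsIn U) :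
    ¬ e.IsDiag := by
  obtain ⟨a, b, -, -, hab, rfl⟩ := mem_pairsIn.1 he
  simpa using hab

lemma exists_minCover_saturates (σ : EdgeOrdering n) (i : ℕ) :
    ∃ C f, IsMinCover (KonigProc σ i) C ∧ Saturates (KonigProc σ i) C f ∧
      C.card = matchNum (KonigProc σ i) := by
  obtain ⟨C, hC⟩ := exists_isVertexCover (KonigProc σ i)
  obtain ⟨f, hf⟩ := IsMinCover.exists_saturates (isKonig_konigProc σ i) hC
  exact ⟨C, f, hC, hf, hC.2.trans (isKonig_konigProc σ i).symm⟩

section Even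

variable {k : ℕ}

/-- Half the number of vertices missed by a maximum matching, on an even vertex set. -/
def deficit (G : SimpleGraph (Fin (2 * k))) : ℕ := k - matchNum G

lemma deficit_anti {G H : SimpleGraph (Fin (2 * k))} (h : G ≤ H) : deficit H ≤ deficit G :=
  Nat.sub_le_sub_left (matchNum_mono h) k

lemma matchNum_add_deficit (σ : EdgeOrdering (2 * k)) (i : ℕ) :
    matchNum (KonigProc σ i) + deficit (KonigProc σ i) = k := by
  obtain ⟨C, f, -, hf, hc⟩ := exists_minCover_saturates σ i
  have := hf.card_missed
  unfold deficit
  omega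

lemma deficit_step_lt (σ : EdgeOrdering (2 * k)) (i : ℕ) {e : Sym2 (Fin (2 * k))}
    (h : matchNum (KonigProc σ i) < matchNum (addEdge (KonigProc σ i) e))
    (hpos : deficit (KonigProc σ i) ≠ 0) :
    deficit (step (KonigProc σ i) e) < deficit (KonigProc σ i) := by
  have := matchNum_lt_step (isKonig_konigProc σ i) h
  unfold deficit at *
  omega

/-- As long as many vertices are unmatched, augmenting pairs are frequent. -/
lemma pr_lt_deficit_le {x b : ℕ} (hb : b ≤ numPairs (2 * k)) {lam : ℝ} (hl : 0 ≤ lam)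
    (hl1 : lam ≤ 1) (hlam : lam * numPairs (2 * k) ≤ ((x : ℝ) ^ 2 - b) / 2) :
    Pr (2 * k) (fun σ => x < deficit (KonigProc σ b)) ≤ 2 ^ k * Real.exp (-(lam * b)) := by
  have := pr_le_of_drift (n := 2 * k)
    (fun i σ => if x < deficit (KonigProc σ i) then (2 : ℝ) ^ deficit (KonigProc σ i) else 0)
    (Nat.zero_le b) hb hl hl1 (K := 2 ^ k) (by positivity) ?_ ?_ ?_ ?_
    (A := fun σ => x < deficit (KonigProc σ b)) ?_
  · simpa using this
  · intro σ
    split_ifs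
    · exact pow_le_pow_right₀ one_le_two (Nat.sub_le _ _)
    · positivity
  · intro i σ
    split_ifs <;> positivity
  · intro i _ _ σ j hij
    have h1 : deficit (KonigProc (swapAt σ i j) (i + 1)) ≤ deficit (KonigProc σ i) := by
      rw [konigProc_swapAt_succ σ hij]
      exact deficit_anti (le_step _ _)
    by_cases h : x < deficit (KonigProc (swapAt σ i j) (i + 1))
    · rw [if_pos h, if_pos (h.trans_le h1)]
      exact pow_le_pow_right₀ one_le_two h1
    · rw [if_neg h]
      split_ifs <;> positivity
  · intro i _ hib σ hne
    have hx : x < deficit (KonigProc σ i) := by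
      by_contra h
      exact hne (if_neg h)
    obtain ⟨C, f, hC, hf, hc⟩ := exists_minCover_saturates σ i
    have hcard := hf.card_missed
    have hdef := matchNum_add_deficit σ i
    refine ⟨pairsIn (missed C f), 1 / 2, by norm_num, fun e => not_isDiag_of_mem_pairsIn, ?_, ?_⟩
    · intro j hij hj
      obtain ⟨p, q, hp, hq, hpq, he⟩ := mem_pairsIn.1 hj
      have hlt : deficit (KonigProc (swapAt σ i j) (i + 1)) < deficit (KonigProc σ i) := by
        rw [konigProc_swapAt_succ σ hij]
        refine deficit_step_lt σ i ?_ (by omega)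
        rw [he, ← hc]
        exact hf.lt_matchNum_addEdge hpq (mem_missed.1 hp).1 (mem_missed.1 hq).1
          (mem_missed.1 hp).2 (mem_missed.1 hq).2
      rw [if_pos hx]
      split_ifs
      · calc (2 : ℝ) ^ deficit (KonigProc (swapAt σ i j) (i + 1))
            ≤ 2 ^ (deficit (KonigProc σ i) - 1) := pow_le_pow_right₀ one_le_two (by omega)
          _ = (1 - 1 / 2) * 2 ^ (deficit (KonigProc σ i) - 1 + 1) := by ring
          _ = _ := by rw [Nat.sub_add_cancel (by omega)]
      · positivity
    · have hU : (missed C f).card = 2 * deficit (KonigProc σ i) := by omega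
      have h1 : x ^ 2 ≤ (pairsIn (missed C f)).card := by
        rw [card_pairsIn, hU, Nat.choose_two_right, mul_assoc,
          Nat.mul_div_cancel_left _ two_pos, sq]
        exact Nat.mul_le_mul hx.le (by omega)
      have h2 := card_revealed_le σ i (pairsIn (missed C f))
      have h3 : ((revealed σ i (pairsIn (missed C f))).card : ℝ) ≤ b := by
        exact_mod_cast h2.trans hib.le
      have h4 : ((x : ℝ) ^ 2) ≤ (pairsIn (missed C f)).card := by exact_mod_cast h1
      linarith
  · intro σ hσ
    simp only [hσ, if_true]
    exact one_le_pow₀ one_le_two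

/-- A small set is unlikely to keep all its neighbours inside another small set. -/
lemma pr_confined_le (S T : Finset (Fin (2 * k))) (hT : T.card ≤ S.card) (hS : S.card ≤ k)
    {x a b : ℕ} {D : ℝ} (hab : a ≤ b) (hb : b ≤ numPairs (2 * k)) {lam : ℝ} (hl : 0 ≤ lam)
    (hl1 : lam ≤ 1)
    (hlam : lam * numPairs (2 * k) ≤ S.card * ((k : ℝ) - x - S.card - D)) :
    Pr (2 * k) (fun σ => DegBound D b σ ∧ deficit (KonigProc σ a) ≤ x ∧
      ∀ u ∈ S, ∀ w, (KonigProc σ b).Adj u w → w ∈ T) ≤ Real.exp (-(lam * ((b : ℝ) - a))) := by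
  refine pr_le_of_kill (fun i σ => DegBound D i σ ∧ deficit (KonigProc σ a) ≤ x ∧
      ∀ u ∈ S, ∀ w, (KonigProc σ i).Adj u w → w ∈ T) hab hb hl hl1 ?_ ?_
  · rintro i hai - σ j hij ⟨h1, h2, h3⟩
    refine ⟨h1.of_swapAt hij, ?_, ?_⟩
    · rwa [konigProc_swapAt σ hij hai] at h2
    · intro u hu w huw
      refine h3 u hu w ?_
      rw [konigProc_swapAt_succ σ hij]
      exact le_step _ _ huw
  · rintro i hai hib σ ⟨hdeg, hdef, -⟩
    obtain ⟨C, f, hC, hf, hc⟩ := exists_minCover_saturates σ i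
    have hCx : k ≤ C.card + x := by
      have h1 := matchNum_add_deficit σ i
      have h2 := deficit_anti (konigProc_mono σ hai)
      omega
    have hC2 := hf.card_missed
    let W : Fin (2 * k) → Finset (Fin (2 * k)) := fun u =>
      if u ∈ C then Finset.univ \ (T ∪ S) else C \ T
    have hW1 : ∀ u ∈ S, ∀ w ∈ W u, u ≠ w ∧ w ∉ T ∧ (u ∈ C ∨ w ∈ C) := by
      intro u hu w hw
      simp only [W] at hw
      split_ifs at hw with h
      · simp only [Finset.mem_sdiff, Finset.mem_univ, Finset.mem_union, not_or, true_and] at hw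
        exact ⟨fun h' => hw.2 (h' ▸ hu), hw.1, Or.inl h⟩
      · rw [Finset.mem_sdiff] at hw
        exact ⟨fun h' => h (h' ▸ hw.1), hw.2, Or.inr hw.1⟩
    let F : Finset (Sym2 (Fin (2 * k))) := (S.sigma W).image fun p => s(p.1, p.2)
    have hF : ∀ e ∈ F, ∃ u ∈ S, ∃ w ∈ W u, e = s(u, w) := by
      intro e he
      obtain ⟨⟨u, w⟩, hp, rfl⟩ := Finset.mem_image.1 he
      obtain ⟨hu, hw⟩ := Finset.mem_sigma.1 hp
      exact ⟨u, hu, w, hw, rfl⟩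
    have hFcard : (S.card : ℝ) * ((k : ℝ) - x - S.card) ≤ F.card := by
      have hinj : Set.InjOn (fun p : (_ : Fin (2 * k)) × Fin (2 * k) => s(p.1, p.2))
          (S.sigma W) := by
        rintro ⟨u, w⟩ hp ⟨u', w'⟩ hp' h
        obtain ⟨hu, hw⟩ := Finset.mem_sigma.1 (Finset.mem_coe.1 hp)
        obtain ⟨hu', hw'⟩ := Finset.mem_sigma.1 (Finset.mem_coe.1 hp')
        rcases Sym2.eq_iff.1 h with ⟨h1, h2⟩ | ⟨h1, h2⟩
        · simp only at h1 h2
          rw [h1, h2]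
        · simp only at h1 h2 hu hw hu' hw'
          subst h1 h2
          exfalso
          simp only [W] at hw hw'
          split_ifs at hw hw' <;> simp_all
      rw [Finset.card_image_of_injOn hinj, Finset.card_sigma, Nat.cast_sum, ← nsmul_eq_mul]
      refine Finset.card_nsmul_le_sum _ _ _ fun u _ => ?_
      simp only [W]
      have hCx' : (k : ℝ) ≤ C.card + x := by exact_mod_cast hCx
      split_ifs
      · have h1 := Finset.card_sdiff_add_card_eq_card (Finset.subset_univ (T ∪ S))
        have h2 := Finset.card_union_le T S
        rw [Finset.card_univ, Fintype.card_fin] at h1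
        have h3 : k ≤ (Finset.univ \ (T ∪ S)).card + S.card := by
          have := hS
          omega
        have h4 : (k : ℝ) ≤ (Finset.univ \ (T ∪ S)).card + S.card := by exact_mod_cast h3
        have : (0 : ℝ) ≤ x := Nat.cast_nonneg _
        linarith
      · have h1 := Finset.le_card_sdiff T C
        have h2 : C.card ≤ (C \ T).card + S.card := by omega
        have h3 : (C.card : ℝ) ≤ (C \ T).card + S.card := by exact_mod_cast h2
        linarith
    refine ⟨F, ?_, ?_, ?_⟩
    · intro e he
      obtain ⟨u, hu, w, hw, rfl⟩ := hF e he
      simpa using (hW1 u hu w hw).1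
    · rintro j hij hj ⟨-, -, h⟩
      obtain ⟨u, hu, w, hw, he⟩ := hF _ hj
      obtain ⟨hne, hwT, hor⟩ := hW1 u hu w hw
      refine hwT (h u hu w ?_)
      rw [konigProc_swapAt_succ σ hij, he]
      have hs : step (KonigProc σ i) s(u, w) = addEdge (KonigProc σ i) s(u, w) := by
        rcases hor with h' | h'
        · exact step_eq_of_cover (isKonig_konigProc σ i) hC h' (by simp)
        · exact step_eq_of_cover (isKonig_konigProc σ i) hC h' (by simp)
      rw [hs]
      exact addEdge_adj hne
    · have h1 := hdeg.card_revealed_le (F := F) (S := S) fun e he => by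
        obtain ⟨u, hu, w, hw, rfl⟩ := hF e he
        exact ⟨u, hu, by simp⟩
      have h2 : (S.card : ℝ) * ((k : ℝ) - x - S.card - D) =
        S.card * ((k : ℝ) - x - S.card) - S.card * D := by ring
      linarith

end Even

/-- A slowly growing weight, `phi j = ∏_{1 ≤ l < j} (2 l + 1) / (2 l)` for `j ≥ 1`. -/
def phi : ℕ → ℝ
  | 0 => 0
  | 1 => 1
  | j + 2 => phi (j + 1) * ((2 * j + 3) / (2 * j + 2))

lemma phi_pos (j : ℕ) : 1 ≤ phi (j + 1) := by
  induction j with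
  | zero => exact le_rfl
  | succ j ih =>
    rw [phi]
    have : (1 : ℝ) ≤ (2 * j + 3) / (2 * j + 2) := by
      rw [one_le_div (by positivity)]
      linarith
    nlinarith

lemma phi_nonneg (j : ℕ) : 0 ≤ phi j := by
  cases j with
  | zero => exact le_rfl
  | succ j => linarith [phi_pos j]

lemma phi_eq_sub (j : ℕ) : phi j = (1 - 1 / (2 * j + 1)) * phi (j + 1) := by
  cases j with
  | zero => simp [phi]
  | succ j =>
    rw [phi]
    push_cast
    field_simp
    ring

lemma phi_mono : Monotone phi := by
  refine monotone_nat_of_le_succ fun j => ?_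
  rw [phi_eq_sub j]
  have h1 : (0 : ℝ) ≤ 1 / (2 * j + 1) := by positivity
  nlinarith [phi_nonneg (j + 1)]

lemma phi_sq_le (j : ℕ) : phi (j + 1) ^ 2 ≤ 2 * (2 * j + 1) := by
  induction j with
  | zero => simp [phi]
  | succ j ih =>
    rw [phi, mul_pow, div_pow]
    have h : (0 : ℝ) ≤ (2 * j + 3) ^ 2 / (2 * j + 2) ^ 2 := by positivity
    refine (mul_le_mul_of_nonneg_right ih h).trans ?_
    push_cast
    rw [mul_div_assoc', div_le_iff₀ (by positivity)]
    have : (0 : ℝ) ≤ j := Nat.cast_nonneg j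
    nlinarith [pow_nonneg this 2, pow_nonneg this 3]

lemma phi_le {k j : ℕ} (hj : j ≤ k) : phi j ≤ 2 * Real.sqrt k := by
  cases j with
  | zero => simp [phi]
  | succ j =>
    rw [← Real.sqrt_sq (phi_nonneg (j + 1)),
      show (2 : ℝ) = Real.sqrt (2 ^ 2) from (Real.sqrt_sq two_pos.le).symm,
      ← Real.sqrt_mul (by positivity)]
    refine Real.sqrt_le_sqrt ((phi_sq_le j).trans ?_)
    have : ((j : ℝ) + 1) ≤ k := by exact_mod_cast hj
    linarith

section Even

variable {k : ℕ}

/-- Every nonempty set of at most `y` vertices has at least as many neighbours as elements. -/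
def Expands (G : SimpleGraph (Fin n)) (y : ℕ) : Prop :=
  ∀ S T : Finset (Fin n), T.card + 1 = S.card → S.card ≤ y →
    ¬ ∀ u ∈ S, ∀ w, G.Adj u w → w ∈ T

/-- In the presence of expansion, the remaining unmatched vertices get matched. -/
lemma pr_deficit_ne_zero_le {x y a₀ a b : ℕ} {D : ℝ} (hD : 0 ≤ D) (ha : a₀ ≤ a) (hab : a ≤ b)
    (hb : b ≤ numPairs (2 * k)) {lam : ℝ} (hl : 0 ≤ lam) (hl1 : lam ≤ 1)
    (hlam : lam * numPairs (2 * k) ≤ (y : ℝ) - 2 * x - 2 * D) :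
    Pr (2 * k) (fun σ => DegBound D b σ ∧ deficit (KonigProc σ a₀) ≤ x ∧
      Expands (KonigProc σ a) y ∧ deficit (KonigProc σ b) ≠ 0) ≤
      2 * Real.sqrt k * Real.exp (-(lam * ((b : ℝ) - a))) := by
  let Q : ℕ → EdgeOrdering (2 * k) → Prop := fun i σ =>
    DegBound D i σ ∧ deficit (KonigProc σ a₀) ≤ x ∧ Expands (KonigProc σ a) y
  refine pr_le_of_drift (n := 2 * k)
    (fun i σ => if Q i σ then phi (deficit (KonigProc σ i)) else 0) hab hb hl hl1
    (by positivity) ?_ ?_ ?_ ?_ ?_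
  · intro σ
    split_ifs
    · exact phi_le (Nat.sub_le _ _)
    · positivity
  · intro i σ
    split_ifs
    · exact phi_nonneg _
    · exact le_rfl
  · intro i hai _ σ j hij
    have h1 : deficit (KonigProc (swapAt σ i j) (i + 1)) ≤ deficit (KonigProc σ i) := by
      rw [konigProc_swapAt_succ σ hij]
      exact deficit_anti (le_step _ _)
    by_cases h : Q (i + 1) (swapAt σ i j)
    · have h' : Q i σ := by
        obtain ⟨h2, h3, h4⟩ := h
        rw [konigProc_swapAt σ hij (ha.trans hai)] at h3
        rw [konigProc_swapAt σ hij hai] at h4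
        exact ⟨h2.of_swapAt hij, h3, h4⟩
      rw [if_pos h, if_pos h']
      exact phi_mono h1
    · rw [if_neg h]
      split_ifs
      · exact phi_nonneg _
      · exact le_rfl
  · intro i hai hib σ hne
    have hQ : Q i σ := by
      by_contra h
      exact hne (if_neg h)
    simp only [if_pos hQ] at hne ⊢
    obtain ⟨hdeg, hx, hexp⟩ := hQ
    obtain ⟨r, hr⟩ : ∃ r, deficit (KonigProc σ i) = r + 1 := by
      refine Nat.exists_eq_succ_of_ne_zero fun h => hne ?_
      rw [h]; rfl
    have hrx : r + 1 ≤ x := by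
      rw [← hr]
      exact (deficit_anti (konigProc_mono σ (ha.trans hai))).trans hx
    obtain ⟨C, f, hC, hf, hc⟩ := exists_minCover_saturates σ i
    have hcard := hf.card_missed
    have hdef := matchNum_add_deficit σ i
    have hU : (missed C f).card = 2 * (r + 1) := by omega
    obtain ⟨X, hUX, hXC, hX, A, -, hXA, hAX⟩ := exists_exchange_set hf hC.1
    have hyX : y < X.card := by
      by_contra! h
      obtain ⟨T, hAT, hT⟩ : ∃ T, A ⊆ T ∧ T.card = X.card - 1 := by
        obtain ⟨T, hAT, -, hT⟩ := Finset.exists_subsuperset_card_eq (Finset.subset_univ A)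
          (n := X.card - 1) (by omega) ((Nat.sub_le _ _).trans (Finset.card_le_univ X))
        exact ⟨T, hAT, hT⟩
      refine hexp X T (by omega) h fun u hu w huw => hAT (hXA u hu w ?_)
      exact konigProc_mono σ hai huw
    choose! u₀ hu₀ g hg hxg hug using hX
    let F : Finset (Sym2 (Fin (2 * k))) :=
      ((X \ missed C f).sigma fun p => (missed C f).erase (u₀ p)).image fun p => s(p.1, p.2)
    have hF : ∀ e ∈ F, ∃ p ∈ X, p ∉ missed C f ∧ ∃ u ∈ missed C f, u ≠ u₀ p ∧ e = s(p, u) := by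
      intro e he
      obtain ⟨⟨p, u⟩, hp, rfl⟩ := Finset.mem_image.1 he
      obtain ⟨hp, hu⟩ := Finset.mem_sigma.1 hp
      obtain ⟨hp1, hp2⟩ := Finset.mem_sdiff.1 hp
      obtain ⟨hu1, hu2⟩ := Finset.mem_erase.1 hu
      exact ⟨p, hp1, hp2, u, hu2, hu1, rfl⟩
    have hFcard : F.card = (X.card - 2 * (r + 1)) * (2 * r + 1) := by
      have hinj : Set.InjOn (fun p : (_ : Fin (2 * k)) × Fin (2 * k) => s(p.1, p.2))
          ((X \ missed C f).sigma fun p => (missed C f).erase (u₀ p)) := by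
        rintro ⟨u, w⟩ hp ⟨u', w'⟩ hp' h
        obtain ⟨hu, hw⟩ := Finset.mem_sigma.1 (Finset.mem_coe.1 hp)
        obtain ⟨hu', hw'⟩ := Finset.mem_sigma.1 (Finset.mem_coe.1 hp')
        rcases Sym2.eq_iff.1 h with ⟨h1, h2⟩ | ⟨h1, h2⟩
        · simp only at h1 h2
          rw [h1, h2]
        · simp only at h1 h2 hu hw hu' hw'
          subst h1 h2
          exact absurd (Finset.mem_of_mem_erase hw') (Finset.mem_sdiff.1 hu).2
      rw [Finset.card_image_of_injOn hinj, Finset.card_sigma, Finset.sum_const_nat (m := 2 * r + 1),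
        Finset.card_sdiff_of_subset hUX, hU]
      intro p hp
      rw [Finset.card_erase_of_mem (hu₀ p (Finset.mem_sdiff.1 hp).1), hU]
      omega
    refine ⟨F, 1 / (2 * r + 1), by positivity, ?_, ?_, ?_⟩
    · intro e he
      obtain ⟨p, -, hp, u, hu, -, rfl⟩ := hF e he
      simp only [Sym2.mk_isDiag_iff]
      exact fun h => hp (h ▸ hu)
    · intro j hij hj
      obtain ⟨p, hpX, hp, u, hu, hne', he⟩ := hF _ hj
      have hlt : deficit (KonigProc (swapAt σ i j) (i + 1)) ≤ r := by
        rw [konigProc_swapAt_succ σ hij, ← Nat.lt_succ_iff, Nat.succ_eq_add_one, ← hr]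
        refine deficit_step_lt σ i ?_ (by omega)
        rw [he, ← hc]
        have h1 := mem_missed.1 (hxg p hpX)
        have h2 := mem_missed.1 (hug p hpX u hu hne')
        exact (hg p hpX).lt_matchNum_addEdge (fun h => hp (h ▸ hu)) h1.1 h2.1 h1.2 h2.2
      rw [hr, ← phi_eq_sub]
      split_ifs
      · exact phi_mono hlt
      · exact phi_nonneg _
    · have h1 := hdeg.card_revealed_le (F := F) (S := missed C f) fun e he => by
        obtain ⟨p, -, -, u, hu, -, rfl⟩ := hF e he
        exact ⟨u, hu, by simp⟩
      rw [hU] at h1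
      rw [hFcard, one_div, inv_mul_eq_div, le_div_iff₀ (by positivity)]
      have h2 : 2 * (r + 1) ≤ X.card := by omega
      push_cast [Nat.cast_sub h2] at h1 ⊢
      have h3 : (y : ℝ) ≤ X.card := by exact_mod_cast hyX.le
      have h4 : (r : ℝ) + 1 ≤ x := by exact_mod_cast hrx
      have h5 : (0 : ℝ) ≤ r := Nat.cast_nonneg r
      have h6 : lam * numPairs (2 * k) ≤ (X.card : ℝ) - 2 * (r + 1) - 2 * D := by linarith
      have h7 := mul_le_mul_of_nonneg_right h6 (by positivity : (0 : ℝ) ≤ 2 * r + 1)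
      nlinarith
  · rintro σ ⟨h1, h2, h3, h4⟩
    have hQ : Q b σ := ⟨h1, h2, h3⟩
    simp only [if_pos hQ]
    obtain ⟨r, hr⟩ := Nat.exists_eq_succ_of_ne_zero h4
    rw [hr]
    exact phi_pos r

end Even

/-- The vertices lying in some minimum vertex cover. -/
def coverable (G : SimpleGraph (Fin n)) : Finset (Fin n) :=
  Finset.univ.filter fun v => ∃ C, IsMinCover G C ∧ v ∈ C

lemma mem_coverable {G : SimpleGraph (Fin n)} {v : Fin n} :
    v ∈ coverable G ↔ ∃ C, IsMinCover G C ∧ v ∈ C := by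
  simp [coverable]

lemma adj_step_of_mem_coverable {G : SimpleGraph (Fin n)} (hG : IsKonig G) {v w : Fin n}
    (hv : v ∈ coverable G) (hvw : v ≠ w) : (step G s(v, w)).Adj v w := by
  obtain ⟨C, hC, hvC⟩ := mem_coverable.1 hv
  rw [step_eq_of_cover hG hC hvC (by simp)]
  exact addEdge_adj hvw

section Even

variable {k : ℕ}

lemma coverNum_eq_of_deficit {σ : EdgeOrdering (2 * k)} {a i : ℕ} (hai : a ≤ i)
    (h : deficit (KonigProc σ a) = 0) : coverNum (KonigProc σ i) = k := by
  have h1 := matchNum_add_deficit σ i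
  have h2 := deficit_anti (konigProc_mono σ hai)
  rw [← isKonig_konigProc σ i]
  omega

lemma IsMinCover.of_le {σ : EdgeOrdering (2 * k)} {a i j : ℕ} (hai : a ≤ i) (hij : i ≤ j)
    (h : deficit (KonigProc σ a) = 0) {C : Finset (Fin (2 * k))}
    (hC : IsMinCover (KonigProc σ j) C) : IsMinCover (KonigProc σ i) C :=
  ⟨IsVertexCover.anti (konigProc_mono σ hij) hC.1, by
    rw [hC.2, coverNum_eq_of_deficit hai h, coverNum_eq_of_deficit (hai.trans hij) h]⟩

lemma coverable_anti {σ : EdgeOrdering (2 * k)} {a i j : ℕ} (hai : a ≤ i) (hij : i ≤ j)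
    (h : deficit (KonigProc σ a) = 0) :
    coverable (KonigProc σ j) ⊆ coverable (KonigProc σ i) := by
  intro v hv
  obtain ⟨C, hC, hvC⟩ := mem_coverable.1 hv
  exact mem_coverable.2 ⟨C, hC.of_le hai hij h, hvC⟩

/-- A set `C` is unlikely to remain a minimum cover while there are many vertices outside `C`
in other minimum covers. -/
lemma pr_lt_card_coverable_le (C : Finset (Fin (2 * k))) (hCk : C.card = k) {z a b : ℕ}
    (hab : a ≤ b) (hb : b ≤ numPairs (2 * k)) {lam : ℝ} (hl : 0 ≤ lam) (hl1 : lam ≤ 1)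
    (hlam : lam * numPairs (2 * k) ≤ (z : ℝ) ^ 2 / 2 - b) :
    Pr (2 * k) (fun σ => deficit (KonigProc σ a) = 0 ∧ IsVertexCover (KonigProc σ b) C ∧
      k + z < (coverable (KonigProc σ b)).card) ≤ Real.exp (-(lam * ((b : ℝ) - a))) := by
  refine pr_le_of_kill (fun i σ => deficit (KonigProc σ a) = 0 ∧
    IsVertexCover (KonigProc σ i) C ∧ k + z < (coverable (KonigProc σ i)).card)
    hab hb hl hl1 ?_ ?_
  · rintro i hai - σ j hij ⟨h1, h2, h3⟩
    have h4 := Finset.card_le_card (coverable_anti hai (Nat.le_succ i) h1)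
    have h5 := IsVertexCover.anti (konigProc_mono _ (Nat.le_succ i)) h2
    rw [konigProc_swapAt σ hij le_rfl] at h4 h5
    rw [konigProc_swapAt σ hij hai] at h1
    exact ⟨h1, h5, h3.trans_le h4⟩
  · rintro i hai hib σ ⟨hdef, hC, hcard⟩
    refine ⟨pairsIn (coverable (KonigProc σ i) \ C), fun e => not_isDiag_of_mem_pairsIn, ?_, ?_⟩
    · rintro j hij hj ⟨-, h, -⟩
      obtain ⟨p, q, hp, hq, hpq, he⟩ := mem_pairsIn.1 hj
      rw [konigProc_swapAt_succ σ hij, he] at h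
      obtain ⟨hp1, hp2⟩ := Finset.mem_sdiff.1 hp
      exact (isVertexCover_iff.1 h p q
        (adj_step_of_mem_coverable (isKonig_konigProc σ i) hp1 hpq)).elim hp2
        (Finset.mem_sdiff.1 hq).2
    · have h1 := Finset.le_card_sdiff C (coverable (KonigProc σ i))
      have h2 : z + 1 ≤ (coverable (KonigProc σ i) \ C).card := by omega
      have h3 : ((z + 1).choose 2 : ℝ) ≤ ((pairsIn (coverable (KonigProc σ i) \ C)).card : ℝ) := by
        rw [card_pairsIn]
        exact_mod_cast Nat.choose_le_choose 2 h2
      have h4 : ((revealed σ i (pairsIn (coverable (KonigProc σ i) \ C))).card : ℝ) ≤ b := by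
        exact_mod_cast (card_revealed_le σ i _).trans hib.le
      rw [Nat.cast_choose_two] at h3
      push_cast at h3
      have : (0 : ℝ) ≤ z := Nat.cast_nonneg z
      nlinarith

/-- A vertex is unlikely to remain undecided once few vertices lie in minimum covers. -/
lemma pr_undecided_le (v : Fin (2 * k)) {z a₀ a b : ℕ} {D : ℝ} (ha : a₀ ≤ a) (hab : a ≤ b)
    (hb : b ≤ numPairs (2 * k)) {lam : ℝ} (hl : 0 ≤ lam) (hl1 : lam ≤ 1)
    (hlam : lam * numPairs (2 * k) ≤ (k : ℝ) - z - D) :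
    Pr (2 * k) (fun σ => DegBound D b σ ∧ deficit (KonigProc σ a₀) = 0 ∧
      (coverable (KonigProc σ a)).card ≤ k + z ∧ v ∈ coverable (KonigProc σ b) ∧
      ∃ C, IsMinCover (KonigProc σ b) C ∧ v ∉ C) ≤ Real.exp (-(lam * ((b : ℝ) - a))) := by
  refine pr_le_of_kill (fun i σ => DegBound D i σ ∧ deficit (KonigProc σ a₀) = 0 ∧
      (coverable (KonigProc σ a)).card ≤ k + z ∧ v ∈ coverable (KonigProc σ i) ∧
      ∃ C, IsMinCover (KonigProc σ i) C ∧ v ∉ C) hab hb hl hl1 ?_ ?_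
  · rintro i hai - σ j hij ⟨h1, h2, h3, h4, C, hC, hvC⟩
    have h5 := coverable_anti (ha.trans hai) (Nat.le_succ i) h2 h4
    have h6 := hC.of_le (ha.trans hai) (Nat.le_succ i) h2
    rw [konigProc_swapAt σ hij le_rfl] at h5 h6
    rw [konigProc_swapAt σ hij (ha.trans hai)] at h2
    rw [konigProc_swapAt σ hij hai] at h3
    exact ⟨h1.of_swapAt hij, h2, h3, h5, C, h6, hvC⟩
  · rintro i hai hib σ ⟨hdeg, hdef, hcard, hv, -⟩
    let F : Finset (Sym2 (Fin (2 * k))) := (coverable (KonigProc σ i))ᶜ.image fun w => s(v, w)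
    have hF : ∀ e ∈ F, ∃ w, w ∉ coverable (KonigProc σ i) ∧ e = s(v, w) := by
      intro e he
      obtain ⟨w, hw, rfl⟩ := Finset.mem_image.1 he
      exact ⟨w, Finset.mem_compl.1 hw, rfl⟩
    refine ⟨F, ?_, ?_, ?_⟩
    · intro e he
      obtain ⟨w, hw, rfl⟩ := hF e he
      rw [Sym2.mk_isDiag_iff]
      exact fun h => hw (h ▸ hv)
    · rintro j hij hj ⟨-, h2, -, -, C, hC, hvC⟩
      obtain ⟨w, hw, he⟩ := hF _ hj
      have h6 := hC.of_le (ha.trans hai) (Nat.le_succ i) h2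
      rw [konigProc_swapAt σ hij le_rfl] at h6
      have h7 := hC.1
      rw [konigProc_swapAt_succ σ hij, he] at h7
      rcases isVertexCover_iff.1 h7 v w
        (adj_step_of_mem_coverable (isKonig_konigProc σ i) hv fun h => hw (h ▸ hv)) with h | h
      · exact hvC h
      · exact hw (mem_coverable.2 ⟨C, h6, h⟩)
    · have h1 := hdeg.card_revealed_le (F := F) (S := {v}) fun e he => by
        obtain ⟨w, hw, rfl⟩ := hF e he
        exact ⟨v, by simp⟩
      rw [Finset.card_singleton, Nat.cast_one, one_mul] at h1
      have h2 : F.card = 2 * k - (coverable (KonigProc σ i)).card := by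
        rw [Finset.card_image_of_injective _ fun w w' h => Sym2.congr_right.1 h,
          Finset.card_compl, Fintype.card_fin]
      have h3 := Finset.card_le_card (coverable_anti ha hai hdef)
      have h4 : k ≤ F.card + z := by omega
      have h5 : (k : ℝ) ≤ F.card + z := by exact_mod_cast h4
      linarith

end Even

lemma existsUnique_minCover {G : SimpleGraph (Fin n)}
    (h : ∀ v ∈ coverable G, ∀ C, IsMinCover G C → v ∈ C) :
    ∃! C : Finset (Fin n), IsVertexCover G C ∧ C.card = coverNum G := by
  obtain ⟨C, hC⟩ := exists_isVertexCover G
  have key : ∀ A B, IsMinCover G A → IsMinCover G B → A ⊆ B := fun A B hA hB v hv =>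
    h v (mem_coverable.2 ⟨A, hA, hv⟩) B hB
  exact ⟨C, hC, fun C' hC' => (key _ _ hC' hC).antisymm (key _ _ hC hC')⟩

section Asymptotics

variable {k : ℕ}

/-- Half the number of vertices is large, quantitatively. -/
structure Large (k : ℕ) : Prop where
  le_log : 10 ^ 7 ≤ Real.log (2 * k)
  log_le : Real.log (2 * k) ≤ 2 * k / 10 ^ 6

lemma eventually_large : ∀ᶠ k : ℕ in Filter.atTop, Large k := by
  have h1 : Filter.Tendsto (fun k : ℕ => (2 * k : ℝ)) Filter.atTop Filter.atTop :=
    tendsto_natCast_atTop_atTop.const_mul_atTop two_pos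
  have h2 := (Real.tendsto_log_atTop.comp h1).eventually_ge_atTop (10 ^ 7)
  have h3 := h1.eventually (Real.isLittleO_log_id_atTop.bound
    (by norm_num : (0 : ℝ) < 1 / 10 ^ 6))
  filter_upwards [h2, h3] with k h2 h3
  refine ⟨h2, (le_abs_self _).trans (h3.trans ?_)⟩
  rw [id, Real.norm_of_nonneg (by positivity)]
  linarith

lemma Large.le (hk : Large k) : (10 : ℝ) ^ 13 ≤ 2 * k := by
  have := hk.1; have := hk.2; linarith

lemma Large.log_pos (hk : Large k) : 0 < Real.log (2 * k) := by linarith [hk.1]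

lemma Large.mul_log_le (hk : Large k) :
    2 * k * Real.log (2 * k) ≤ (2 * k) ^ 2 / 10 ^ 6 := by
  have := mul_le_mul_of_nonneg_left hk.2 (by positivity : (0 : ℝ) ≤ 2 * k)
  linarith

lemma Large.le_mul_log (hk : Large k) :
    10 ^ 7 * (2 * k) ≤ 2 * k * Real.log (2 * k) := by
  have := mul_le_mul_of_nonneg_left hk.1 (by positivity : (0 : ℝ) ≤ 2 * k)
  linarith

lemma Large.exp_log (hk : Large k) : Real.exp (Real.log (2 * k)) = 2 * k :=
  Real.exp_log (by linarith [hk.le])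

lemma cast_numPairs (k : ℕ) : (numPairs (2 * k) : ℝ) = 2 * k * (2 * k - 1) / 2 := by
  have h : numPairs (2 * k) = k * (2 * k - 1) := by
    rw [numPairs, mul_assoc, Nat.mul_div_cancel_left _ two_pos]
  rcases Nat.eq_zero_or_pos k with rfl | hk
  · simp
  · rw [h, Nat.cast_mul, Nat.cast_sub (by omega)]
    push_cast
    ring

/-- The number `⌊c n log n⌋` of steps, where `n = 2 k`. -/
def time (k : ℕ) (c : ℝ) : ℕ := ⌊c * (2 * k * Real.log (2 * k))⌋₊

lemma Large.time_le (hk : Large k) {c : ℝ} (hc : 0 ≤ c) :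
    (time k c : ℝ) ≤ c * (2 * k * Real.log (2 * k)) :=
  Nat.floor_le (mul_nonneg hc (mul_nonneg (by positivity) hk.log_pos.le))

lemma le_time (k : ℕ) (c : ℝ) : c * (2 * k * Real.log (2 * k)) - 1 ≤ time k c :=
  (Nat.sub_one_lt_floor _).le

lemma Large.time_mono (hk : Large k) {c d : ℝ} (h : c ≤ d) : time k c ≤ time k d :=
  Nat.floor_le_floor
    (mul_le_mul_of_nonneg_right h (mul_nonneg (by positivity) hk.log_pos.le))

/-- The number of steps in the main theorem. -/
def lastTime (k : ℕ) : ℕ := ⌈4 * (2 * k) * Real.log (2 * k)⌉₊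

lemma le_lastTime (k : ℕ) : 4 * (2 * k * Real.log (2 * k)) ≤ lastTime k := by
  rw [← mul_assoc]
  exact Nat.le_ceil _

lemma Large.lastTime_le (hk : Large k) :
    (lastTime k : ℝ) ≤ 4 * (2 * k * Real.log (2 * k)) + 1 := by
  rw [← mul_assoc]
  exact (Nat.ceil_lt_add_one (mul_nonneg (by positivity) hk.log_pos.le)).le

lemma Large.time_le_lastTime (hk : Large k) {c : ℝ} (h0 : 0 ≤ c) (h : c ≤ 4) :
    time k c ≤ lastTime k := by
  have h1 := hk.time_le h0
  have h2 := le_lastTime k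
  have h3 := mul_le_mul_of_nonneg_right h
    (mul_nonneg (by positivity) hk.log_pos.le : (0 : ℝ) ≤ 2 * k * Real.log (2 * k))
  exact_mod_cast h1.trans (h3.trans h2)

lemma Large.lastTime_add_le (hk : Large k) :
    (lastTime k : ℝ) + (2 * k) ^ 2 / 4 ≤ numPairs (2 * k) := by
  have h1 := hk.lastTime_le
  have h2 := hk.mul_log_le
  have h3 := hk.le
  rw [cast_numPairs]
  nlinarith

lemma Large.lastTime_le_numPairs (hk : Large k) : lastTime k ≤ numPairs (2 * k) := by
  have h := hk.lastTime_add_le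
  have : (lastTime k : ℝ) ≤ numPairs (2 * k) := by linarith [sq_nonneg (2 * k : ℝ)]
  exact_mod_cast this

lemma Large.rate_bounds (hk : Large k) {ρ c : ℝ} (h0 : 0 ≤ ρ) (h1 : ρ ≤ 2 * k / 2)
    (hc : ρ * (2 * k) ≤ c) :
    0 ≤ 2 * ρ / (2 * k) ∧ 2 * ρ / (2 * k) ≤ 1 ∧ 2 * ρ / (2 * k) * numPairs (2 * k) ≤ c := by
  have hn : (0 : ℝ) < 2 * k := by linarith [hk.le]
  refine ⟨by positivity, (div_le_one hn).2 (by linarith), ?_⟩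
  have : 2 * ρ / (2 * k) * numPairs (2 * k) = ρ * (2 * k - 1) := by
    have hk0 : (k : ℝ) ≠ 0 := fun h => by simp [h] at hn
    rw [cast_numPairs]
    field_simp
  rw [this]
  linarith

lemma Large.exp_rate_le (hk : Large k) {ρ c δ : ℝ} (h0 : 0 ≤ ρ) (h1 : ρ ≤ 2 * k / 2)
    (hδ : c * (2 * k * Real.log (2 * k)) - 1 ≤ δ) :
    Real.exp (-(2 * ρ / (2 * k) * δ)) ≤ Real.exp (1 - 2 * ρ * c * Real.log (2 * k)) := by
  have hn : (0 : ℝ) < 2 * k := by linarith [hk.le]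
  have h2 : 0 ≤ 2 * ρ / (2 * k) := by positivity
  have h3 : 2 * ρ / (2 * k) ≤ 1 := (div_le_one hn).2 (by linarith)
  have h4 := mul_le_mul_of_nonneg_left hδ h2
  have h5 : 2 * ρ / (2 * k) * (c * (2 * k * Real.log (2 * k)) - 1) =
      2 * ρ * c * Real.log (2 * k) - 2 * ρ / (2 * k) := by
    have hk0 : (k : ℝ) ≠ 0 := fun h => by simp [h] at hn
    field_simp
  exact Real.exp_le_exp.2 (by linarith)

lemma two_pow_le_exp (m : ℕ) : (2 : ℝ) ^ m ≤ Real.exp m := by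
  rw [← mul_one (m : ℝ), Real.exp_nat_mul]
  gcongr
  linarith [Real.add_one_le_exp (1 : ℝ)]

/-- A fixed fraction of the vertices. -/
def smallSize (k : ℕ) : ℕ := ⌊(2 * k : ℝ) / 200⌋₊

lemma smallSize_le (k : ℕ) : (smallSize k : ℝ) ≤ 2 * k / 200 := Nat.floor_le (by positivity)

lemma le_smallSize (k : ℕ) : (2 * k : ℝ) / 200 - 1 ≤ smallSize k := (Nat.sub_one_lt_floor _).le

lemma Large.le_smallSize_sq (hk : Large k) :
    (2 * k : ℝ) ^ 2 / 41000 ≤ (smallSize k : ℝ) ^ 2 := by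
  have h1 := le_smallSize k
  have h2 := hk.le
  have h3 : (2 * k : ℝ) / 202 ≤ smallSize k := by linarith
  have h4 := pow_le_pow_left₀ (by positivity) h3 2
  nlinarith

/-- The size up to which sets expand. -/
def expansionSize (k : ℕ) : ℕ := ⌊2 * (2 * k : ℝ) / 5⌋₊

lemma expansionSize_le (k : ℕ) : (expansionSize k : ℝ) ≤ 2 * (2 * k) / 5 :=
  Nat.floor_le (by positivity)

lemma le_expansionSize (k : ℕ) : 2 * (2 * k : ℝ) / 5 - 1 ≤ expansionSize k :=
  (Nat.sub_one_lt_floor _).le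

/-- The error bound for each of the phases. -/
def err (k : ℕ) : ℝ := 2 * Real.exp (1 - 18 / 1000 * Real.log (2 * k))

lemma exp_le_err {k : ℕ} {t : ℝ} (h : t ≤ 1 - 18 / 1000 * Real.log (2 * k)) :
    Real.exp t ≤ err k := by
  have h1 := Real.exp_le_exp.2 h
  have h2 := Real.exp_pos (1 - 18 / 1000 * Real.log (2 * k))
  unfold err
  linarith

lemma tendsto_err : Filter.Tendsto err Filter.atTop (nhds 0) := by
  have h1 : Filter.Tendsto (fun k : ℕ => (2 * k : ℝ)) Filter.atTop Filter.atTop :=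
    tendsto_natCast_atTop_atTop.const_mul_atTop two_pos
  have h2 := ((Real.tendsto_log_atTop.comp h1).const_mul_atTop
    (by norm_num : (0 : ℝ) < 18 / 1000))
  have h3 := Filter.tendsto_atTop_add_const_left Filter.atTop (-1) h2
  have h4 := (Real.tendsto_exp_neg_atTop_nhds_zero.comp h3).const_mul 2
  rw [mul_zero] at h4
  refine h4.congr fun k => ?_
  simp only [Function.comp_apply, err]
  congr 2
  ring

lemma Large.pr_not_degBound_le (hk : Large k) :
    Pr (2 * k) (fun σ => ∃ v ∈ Finset.univ,
      (2 * k / 200 : ℝ) < (revealed σ (lastTime k) (star v)).card) ≤ err k := by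
  have hn : (0 : ℝ) < 2 * k := by linarith [hk.le]
  have hv : ∀ v ∈ (Finset.univ : Finset (Fin (2 * k))), Pr (2 * k) (fun σ =>
      (2 * k / 200 : ℝ) < (revealed σ (lastTime k) (star v)).card) ≤
      (2 : ℝ) ^ (-(2 * k / 200 : ℝ)) * (1 + 4 / (2 * k)) ^ lastTime k := by
    intro v _
    refine pr_lt_card_revealed_star_le v hk.lastTime_le_numPairs (by positivity) ?_
    have h := hk.lastTime_add_le
    rw [mul_div_assoc', le_div_iff₀ hn]
    push_cast
    linarith
  refine ((pr_exists_le _ _).trans (Finset.sum_le_sum hv)).trans ?_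
  rw [Finset.sum_const, Finset.card_univ, Fintype.card_fin, nsmul_eq_mul, Nat.cast_mul,
    Nat.cast_ofNat]
  have h1 : (1 + 4 / (2 * k) : ℝ) ^ lastTime k ≤ Real.exp (17 * Real.log (2 * k)) := by
    calc (1 + 4 / (2 * k) : ℝ) ^ lastTime k ≤ Real.exp (4 / (2 * k)) ^ lastTime k := by
          gcongr
          linarith [Real.add_one_le_exp (4 / (2 * k) : ℝ)]
      _ = Real.exp (lastTime k * (4 / (2 * k))) := (Real.exp_nat_mul _ _).symm
      _ ≤ _ := by
          refine Real.exp_le_exp.2 ?_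
          rw [mul_div_assoc', div_le_iff₀ hn]
          have := hk.lastTime_le
          have := hk.le_mul_log
          have := hk.le
          linarith
  have h2 : (2 : ℝ) ^ (-(2 * k / 200 : ℝ)) = Real.exp (-(Real.log 2 * (2 * k / 200))) := by
    rw [Real.rpow_def_of_pos two_pos]
    congr 1
    ring
  calc (2 * k : ℝ) * ((2 : ℝ) ^ (-(2 * k / 200 : ℝ)) * (1 + 4 / (2 * k)) ^ lastTime k)
      ≤ Real.exp (Real.log (2 * k)) * (Real.exp (-(Real.log 2 * (2 * k / 200))) *
        Real.exp (17 * Real.log (2 * k))) := by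
        rw [hk.exp_log, h2]
        gcongr
    _ = Real.exp (Real.log (2 * k) + (-(Real.log 2 * (2 * k / 200)) +
        17 * Real.log (2 * k))) := by rw [← Real.exp_add, ← Real.exp_add]
    _ ≤ _ := by
        refine exp_le_err ?_
        have h3 := Real.log_two_gt_d9
        have h4 := mul_le_mul_of_nonneg_right h3.le (by positivity : (0 : ℝ) ≤ 2 * k / 200)
        have h5 := hk.2
        linarith

lemma Large.pr_deficit_le (hk : Large k) :
    Pr (2 * k) (fun σ => smallSize k < deficit (KonigProc σ (time k (1 / 20)))) ≤ err k := by
  have hn := hk.le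
  have hT := hk.time_le (by norm_num : (0 : ℝ) ≤ 1 / 20)
  have hx := hk.le_smallSize_sq
  have h1 := hk.mul_log_le
  obtain ⟨hl, hl1, hlam⟩ := hk.rate_bounds (ρ := 2 * k / 100000)
    (c := ((smallSize k : ℝ) ^ 2 - time k (1 / 20)) / 2) (by positivity) (by linarith)
    (by nlinarith)
  refine (pr_lt_deficit_le ((hk.time_le_lastTime (by norm_num) (by norm_num)).trans
    hk.lastTime_le_numPairs) hl hl1 hlam).trans ?_
  have h2 := hk.exp_rate_le (ρ := 2 * k / 100000) (c := 1 / 20) (δ := time k (1 / 20))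
    (by positivity) (by linarith) (le_time k _)
  refine (mul_le_mul (two_pow_le_exp k) h2 (by positivity) (by positivity)).trans ?_
  rw [← Real.exp_add]
  refine exp_le_err ?_
  have h3 := hk.le_mul_log
  have h4 := hk.2
  linarith

lemma choose_mul_choose_le_exp (hk : Large k) {s : ℕ} (hs : 1 ≤ s) :
    ((2 * k).choose s * (2 * k).choose (s - 1) : ℝ) ≤
      Real.exp ((2 * s - 1) * Real.log (2 * k)) := by
  have h : ∀ t : ℕ, ((2 * k).choose t : ℝ) ≤ Real.exp (t * Real.log (2 * k)) := by
    intro t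
    rw [Real.exp_nat_mul, hk.exp_log]
    exact_mod_cast Nat.choose_le_pow (2 * k) t
  refine (mul_le_mul (h s) (h (s - 1)) (by positivity) (by positivity)).trans ?_
  rw [← Real.exp_add, Nat.cast_sub hs, Nat.cast_one]
  exact Real.exp_le_exp.2 (by linarith)

lemma choose_mul_choose_le_exp_four (k s t : ℕ) :
    ((2 * k).choose s * (2 * k).choose t : ℝ) ≤ Real.exp (4 * k) := by
  have h : ∀ t : ℕ, ((2 * k).choose t : ℝ) ≤ Real.exp (2 * k) := by
    intro t
    have h1 := two_pow_le_exp (2 * k)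
    have h2 : ((2 * k).choose t : ℝ) ≤ 2 ^ (2 * k) := by
      exact_mod_cast Nat.choose_le_two_pow (2 * k) t
    push_cast at h1
    exact h2.trans h1
  refine (mul_le_mul (h s) (h t) (by positivity) (by positivity)).trans ?_
  rw [← Real.exp_add]
  exact Real.exp_le_exp.2 (by linarith)

lemma Large.choose_mul_exp_le (hk : Large k) {s : ℕ} (hs : 1 ≤ s) {ρ : ℝ}
    (h1 : 9 / 100 * s ≤ ρ) (h2 : (s : ℝ) ≤ 2 * k / 200 → 485 / 1000 * s ≤ ρ) :
    ((2 * k).choose s * (2 * k).choose (s - 1) : ℝ) *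
      Real.exp (1 - 2 * ρ * (215 / 100) * Real.log (2 * k)) ≤
      Real.exp (1 - 108 / 100 * Real.log (2 * k)) := by
  have hL := hk.log_pos
  have hs' : (1 : ℝ) ≤ s := by exact_mod_cast hs
  by_cases h : (s : ℝ) ≤ 2 * k / 200
  · refine (mul_le_mul_of_nonneg_right (choose_mul_choose_le_exp hk hs)
      (Real.exp_pos _).le).trans ?_
    rw [← Real.exp_add]
    refine Real.exp_le_exp.2 ?_
    have h3 := mul_le_mul_of_nonneg_right (h2 h) hL.le
    have h4 := mul_le_mul_of_nonneg_right hs' hL.le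
    linarith
  · refine (mul_le_mul_of_nonneg_right (choose_mul_choose_le_exp_four k s (s - 1))
      (Real.exp_pos _).le).trans ?_
    rw [← Real.exp_add]
    refine Real.exp_le_exp.2 ?_
    have h3 : 9 / 100 * (2 * k / 200) ≤ ρ := by linarith
    have h4 := mul_le_mul_of_nonneg_right h3 hL.le
    have h5 := hk.le_mul_log
    have h6 := hk.2
    linarith

lemma Large.pr_not_expands_le (hk : Large k) :
    Pr (2 * k) (fun σ => DegBound (2 * k / 200) (time k (22 / 10)) σ ∧
      deficit (KonigProc σ (time k (1 / 20))) ≤ smallSize k ∧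
      ¬ Expands (KonigProc σ (time k (22 / 10))) (expansionSize k)) ≤ err k := by
  have hn := hk.le
  have hx := smallSize_le k
  have hy := expansionSize_le k
  let B : Finset (Fin (2 * k)) → Finset (Fin (2 * k)) → EdgeOrdering (2 * k) → Prop :=
    fun S T σ => DegBound (2 * k / 200) (time k (22 / 10)) σ ∧
      deficit (KonigProc σ (time k (1 / 20))) ≤ smallSize k ∧
      ∀ u ∈ S, ∀ w, (KonigProc σ (time k (22 / 10))).Adj u w → w ∈ T
  have hunion : Pr (2 * k) (fun σ => DegBound (2 * k / 200) (time k (22 / 10)) σ ∧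
      deficit (KonigProc σ (time k (1 / 20))) ≤ smallSize k ∧
      ¬ Expands (KonigProc σ (time k (22 / 10))) (expansionSize k)) ≤
      Pr (2 * k) (fun σ => ∃ s ∈ Finset.Icc 1 (expansionSize k),
        ∃ S ∈ Finset.powersetCard s Finset.univ,
        ∃ T ∈ Finset.powersetCard (s - 1) Finset.univ, B S T σ) := by
    refine pr_mono ?_
    rintro σ ⟨h1, h2, h3⟩
    unfold Expands at h3
    push Not at h3
    obtain ⟨S, T, hTS, hSy, h⟩ := h3
    refine ⟨S.card, Finset.mem_Icc.2 ⟨by omega, hSy⟩, S,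
      Finset.mem_powersetCard.2 ⟨Finset.subset_univ _, rfl⟩, T,
      Finset.mem_powersetCard.2 ⟨Finset.subset_univ _, by omega⟩, h1, h2, h⟩
  have hs : ∀ s ∈ Finset.Icc 1 (expansionSize k),
      Pr (2 * k) (fun σ => ∃ S ∈ Finset.powersetCard s Finset.univ,
        ∃ T ∈ Finset.powersetCard (s - 1) Finset.univ, B S T σ) ≤
      Real.exp (1 - 108 / 100 * Real.log (2 * k)) := by
    intro s hs
    obtain ⟨hs1, hsy⟩ := Finset.mem_Icc.1 hs
    have hs1' : (1 : ℝ) ≤ s := by exact_mod_cast hs1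
    have hsy' : (s : ℝ) ≤ 2 * (2 * k) / 5 := le_trans (by exact_mod_cast hsy) hy
    set ρ : ℝ := s * ((k : ℝ) - smallSize k - s - 2 * k / 200) / (2 * k) with hρ
    have hn0 : (0 : ℝ) < 2 * k := by linarith
    have hρ1 : 9 / 100 * s ≤ ρ := by
      rw [hρ, le_div_iff₀ hn0]
      nlinarith
    have hρ2 : (s : ℝ) ≤ 2 * k / 200 → 485 / 1000 * s ≤ ρ := by
      intro h
      rw [hρ, le_div_iff₀ hn0]
      nlinarith
    have hρ3 : ρ ≤ 2 * k / 2 := by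
      rw [hρ, div_le_iff₀ hn0]
      have : (0 : ℝ) ≤ smallSize k := Nat.cast_nonneg _
      nlinarith
    obtain ⟨hl, hl1, hlam⟩ := hk.rate_bounds (ρ := ρ) (by linarith) hρ3 le_rfl
    have hST : ∀ S ∈ Finset.powersetCard s (Finset.univ : Finset (Fin (2 * k))),
        ∀ T ∈ Finset.powersetCard (s - 1) (Finset.univ : Finset (Fin (2 * k))),
        Pr (2 * k) (B S T) ≤ Real.exp (1 - 2 * ρ * (215 / 100) * Real.log (2 * k)) := by
      intro S hS T hT
      have hS := (Finset.mem_powersetCard.1 hS).2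
      have hT := (Finset.mem_powersetCard.1 hT).2
      have hsk : s ≤ k := by
        have : (s : ℝ) ≤ k := by linarith
        exact_mod_cast this
      refine (pr_confined_le S T (by omega) (by omega) (hk.time_mono (by norm_num))
        ((hk.time_le_lastTime (by norm_num) (by norm_num)).trans hk.lastTime_le_numPairs)
        hl hl1 ?_).trans (hk.exp_rate_le (by linarith) hρ3 ?_)
      · rw [hS]
        refine hlam.trans_eq ?_
        exact div_mul_cancel₀ _ hn0.ne'
      · have h1 := le_time k (22 / 10)
        have h2 := hk.time_le (by norm_num : (0 : ℝ) ≤ 1 / 20)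
        linarith
    have hS : ∀ S ∈ Finset.powersetCard s (Finset.univ : Finset (Fin (2 * k))),
        Pr (2 * k) (fun σ => ∃ T ∈ Finset.powersetCard (s - 1) Finset.univ, B S T σ) ≤
        (2 * k).choose (s - 1) * Real.exp (1 - 2 * ρ * (215 / 100) * Real.log (2 * k)) := by
      intro S hS
      refine ((pr_exists_le _ _).trans (Finset.sum_le_sum (hST S hS))).trans_eq ?_
      rw [Finset.sum_const, Finset.card_powersetCard, Finset.card_univ, Fintype.card_fin,
        nsmul_eq_mul]
    refine ((pr_exists_le _ _).trans (Finset.sum_le_sum hS)).trans ?_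
    rw [Finset.sum_const, Finset.card_powersetCard, Finset.card_univ, Fintype.card_fin,
      nsmul_eq_mul, ← mul_assoc]
    exact hk.choose_mul_exp_le hs1 hρ1 hρ2
  refine (hunion.trans ((pr_exists_le _ _).trans (Finset.sum_le_sum hs))).trans ?_
  rw [Finset.sum_const, Nat.card_Icc, nsmul_eq_mul, Nat.add_sub_cancel]
  have h1 : (expansionSize k : ℝ) ≤ Real.exp (Real.log (2 * k)) := by
    rw [hk.exp_log]
    linarith
  refine (mul_le_mul_of_nonneg_right h1 (Real.exp_pos _).le).trans ?_
  rw [← Real.exp_add]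
  exact exp_le_err (by linarith [hk.log_pos])

lemma Large.pr_deficit_ne_zero_le (hk : Large k) :
    Pr (2 * k) (fun σ => DegBound (2 * k / 200) (time k (29 / 10)) σ ∧
      deficit (KonigProc σ (time k (1 / 20))) ≤ smallSize k ∧
      Expands (KonigProc σ (time k (22 / 10))) (expansionSize k) ∧
      deficit (KonigProc σ (time k (29 / 10))) ≠ 0) ≤ err k := by
  have hn := hk.le
  have hx := smallSize_le k
  have hy := le_expansionSize k
  obtain ⟨hl, hl1, hlam⟩ := hk.rate_bounds (ρ := 37 / 100)
    (c := (expansionSize k : ℝ) - 2 * smallSize k - 2 * (2 * k / 200)) (by norm_num)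
    (by linarith) (by linarith)
  refine (KonigProcess.pr_deficit_ne_zero_le (by positivity) (hk.time_mono (by norm_num))
    (hk.time_mono (by norm_num)) ((hk.time_le_lastTime (by norm_num) (by norm_num)).trans
    hk.lastTime_le_numPairs) hl hl1 hlam).trans ?_
  have h1 := le_time k (29 / 10)
  have h2 := hk.time_le (by norm_num : (0 : ℝ) ≤ 22 / 10)
  have h3 := hk.exp_rate_le (ρ := 37 / 100) (c := 7 / 10)
    (δ := (time k (29 / 10) : ℝ) - time k (22 / 10)) (by norm_num) (by linarith) (by linarith)
  have h4 : Real.sqrt k ≤ Real.exp (Real.log (2 * k) / 2) := by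
    rw [Real.exp_half, hk.exp_log]
    exact Real.sqrt_le_sqrt (by linarith [(Nat.cast_nonneg k : (0 : ℝ) ≤ k)])
  rw [mul_assoc, err]
  refine mul_le_mul_of_nonneg_left ?_ two_pos.le
  refine (mul_le_mul h4 h3 (by positivity) (by positivity)).trans ?_
  rw [← Real.exp_add]
  exact Real.exp_le_exp.2 (by linarith [hk.log_pos])

lemma Large.pr_coverable_le (hk : Large k) :
    Pr (2 * k) (fun σ => ∃ C ∈ Finset.powersetCard k Finset.univ,
      deficit (KonigProc σ (time k (29 / 10))) = 0 ∧
      IsVertexCover (KonigProc σ (time k (295 / 100))) C ∧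
      k + smallSize k < (coverable (KonigProc σ (time k (295 / 100)))).card) ≤ err k := by
  have hn := hk.le
  have hT := hk.time_le (by norm_num : (0 : ℝ) ≤ 295 / 100)
  have hx := hk.le_smallSize_sq
  have h1 := hk.mul_log_le
  obtain ⟨hl, hl1, hlam⟩ := hk.rate_bounds (ρ := 2 * k / 200000)
    (c := (smallSize k : ℝ) ^ 2 / 2 - time k (295 / 100)) (by positivity) (by linarith)
    (by nlinarith)
  have hC : ∀ C ∈ Finset.powersetCard k (Finset.univ : Finset (Fin (2 * k))),
      Pr (2 * k) (fun σ => deficit (KonigProc σ (time k (29 / 10))) = 0 ∧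
      IsVertexCover (KonigProc σ (time k (295 / 100))) C ∧
      k + smallSize k < (coverable (KonigProc σ (time k (295 / 100)))).card) ≤
      Real.exp (1 - 2 * (2 * k / 200000) * (1 / 20) * Real.log (2 * k)) := by
    intro C hC
    refine (pr_lt_card_coverable_le C (Finset.mem_powersetCard.1 hC).2
      (hk.time_mono (by norm_num)) ((hk.time_le_lastTime (by norm_num) (by norm_num)).trans
      hk.lastTime_le_numPairs) hl hl1 hlam).trans
      (hk.exp_rate_le (by positivity) (by linarith) ?_)
    have h2 := le_time k (295 / 100)
    have h3 := hk.time_le (by norm_num : (0 : ℝ) ≤ 29 / 10)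
    linarith
  refine ((pr_exists_le _ _).trans (Finset.sum_le_sum hC)).trans ?_
  rw [Finset.sum_const, Finset.card_powersetCard, Finset.card_univ, Fintype.card_fin,
    nsmul_eq_mul]
  have h2 : ((2 * k).choose k : ℝ) ≤ Real.exp (4 * k) := by
    simpa using choose_mul_choose_le_exp_four k k 0
  refine (mul_le_mul_of_nonneg_right h2 (Real.exp_pos _).le).trans ?_
  rw [← Real.exp_add]
  refine exp_le_err ?_
  have h3 := hk.le_mul_log
  have h4 := hk.2
  linarith

lemma Large.pr_undecided_le (hk : Large k) :
    Pr (2 * k) (fun σ => ∃ v ∈ Finset.univ, DegBound (2 * k / 200) (lastTime k) σ ∧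
      deficit (KonigProc σ (time k (29 / 10))) = 0 ∧
      (coverable (KonigProc σ (time k (295 / 100)))).card ≤ k + smallSize k ∧
      v ∈ coverable (KonigProc σ (lastTime k)) ∧
      ∃ C, IsMinCover (KonigProc σ (lastTime k)) C ∧ v ∉ C) ≤ err k := by
  have hn := hk.le
  have hz := smallSize_le k
  obtain ⟨hl, hl1, hlam⟩ := hk.rate_bounds (ρ := 49 / 100)
    (c := (k : ℝ) - smallSize k - 2 * k / 200) (by norm_num) (by linarith) (by linarith)
  have hv : ∀ v ∈ (Finset.univ : Finset (Fin (2 * k))), Pr (2 * k) (fun σ =>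
      DegBound (2 * k / 200) (lastTime k) σ ∧
      deficit (KonigProc σ (time k (29 / 10))) = 0 ∧
      (coverable (KonigProc σ (time k (295 / 100)))).card ≤ k + smallSize k ∧
      v ∈ coverable (KonigProc σ (lastTime k)) ∧
      ∃ C, IsMinCover (KonigProc σ (lastTime k)) C ∧ v ∉ C) ≤
      Real.exp (1 - 2 * (49 / 100) * (105 / 100) * Real.log (2 * k)) := by
    intro v _
    refine (KonigProcess.pr_undecided_le v (hk.time_mono (by norm_num))
      (hk.time_le_lastTime (by norm_num) (by norm_num)) hk.lastTime_le_numPairs hl hl1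
      hlam).trans (hk.exp_rate_le (by norm_num) (by linarith) ?_)
    have h2 := le_lastTime k
    have h3 := hk.time_le (by norm_num : (0 : ℝ) ≤ 295 / 100)
    linarith
  refine ((pr_exists_le _ _).trans (Finset.sum_le_sum hv)).trans ?_
  rw [Finset.sum_const, Finset.card_univ, Fintype.card_fin, nsmul_eq_mul]
  push_cast
  nth_rewrite 1 [← hk.exp_log]
  rw [← Real.exp_add]
  exact exp_le_err (by linarith [hk.log_pos])

/-- If the minimum cover is not unique, then one of the phases has failed. -/
lemma Large.pr_not_existsUnique_le (hk : Large k) :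
    Pr (2 * k) (fun σ => ¬ ∃! C : Finset (Fin (2 * k)),
      IsVertexCover (KonigProc σ (lastTime k)) C ∧
        C.card = coverNum (KonigProc σ (lastTime k))) ≤ 6 * err k := by
  have h1 := hk.pr_not_degBound_le
  have h2 := hk.pr_deficit_le
  have h3 := hk.pr_not_expands_le
  have h4 := hk.pr_deficit_ne_zero_le
  have h5 := hk.pr_coverable_le
  have h6 := hk.pr_undecided_le
  have h56 := (pr_or_le _ _).trans (add_le_add h5 h6)
  have h46 := (pr_or_le _ _).trans (add_le_add h4 h56)
  have h36 := (pr_or_le _ _).trans (add_le_add h3 h46)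
  have h26 := (pr_or_le _ _).trans (add_le_add h2 h36)
  have h16 := (pr_or_le _ _).trans (add_le_add h1 h26)
  refine le_trans (pr_mono ?_) (h16.trans_eq (by ring))
  intro σ hσ
  by_contra hgood
  simp only [not_or] at hgood
  obtain ⟨g1, g2, g3, g4, g5, g6⟩ := hgood
  have hdeg : DegBound (2 * k / 200) (lastTime k) σ := fun v => by
    by_contra! h
    exact g1 ⟨v, Finset.mem_univ v, h⟩
  have hx := not_lt.1 g2
  have hexp : Expands (KonigProc σ (time k (22 / 10))) (expansionSize k) := by
    by_contra h
    exact g3 ⟨hdeg.anti (hk.time_le_lastTime (by norm_num) (by norm_num)), hx, h⟩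
  have hdef : deficit (KonigProc σ (time k (29 / 10))) = 0 := by
    by_contra h
    exact g4 ⟨hdeg.anti (hk.time_le_lastTime (by norm_num) (by norm_num)), hx, hexp, h⟩
  have hcov : (coverable (KonigProc σ (time k (295 / 100)))).card ≤ k + smallSize k := by
    by_contra! h
    obtain ⟨C, hC, hCc⟩ := exists_isVertexCover (KonigProc σ (time k (295 / 100)))
    rw [coverNum_eq_of_deficit (hk.time_mono (by norm_num)) hdef] at hCc
    exact g5 ⟨C, Finset.mem_powersetCard.2 ⟨Finset.subset_univ C, hCc⟩, hdef, hC, h⟩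
  refine hσ (existsUnique_minCover fun v hv C hC => ?_)
  by_contra h
  exact g6 ⟨v, Finset.mem_univ v, hdeg, hdef, hcov, hv, C, hC, h⟩

end Asymptotics

end KonigProcess

/-- Whp the graph `G_m` of the König process with `m = ⌈4 n log n⌉` has a unique minimum
vertex cover. -/
theorem koenig_process_unique_min_cover :
    Filter.Tendsto (fun k : ℕ =>
      Pr (2*k) (fun σ =>
        ∃! C : Finset (Fin (2*k)),
          IsVertexCover (KonigProc σ ⌈4 * (2*k) * Real.log (2*k)⌉₊) C ∧
          C.card = coverNum (KonigProc σ ⌈4 * (2*k) * Real.log (2*k)⌉₊)))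
      Filter.atTop (nhds 1) := by
  have h0 : Filter.Tendsto (fun k => 1 - 6 * KonigProcess.err k) Filter.atTop (nhds 1) := by
    simpa using (KonigProcess.tendsto_err.const_mul 6).const_sub 1
  refine tendsto_of_tendsto_of_tendsto_of_le_of_le' h0 tendsto_const_nhds ?_ ?_
  · filter_upwards [KonigProcess.eventually_large] with k hk
    rw [KonigProcess.pr_compl]
    have := hk.pr_not_existsUnique_le
    unfold KonigProcess.lastTime at this
    linarith
  · refine Filter.Eventually.of_forall fun k => ?_
    rw [KonigProcess.pr_compl]
    have := KonigProcess.pr_nonneg (n := 2 * k) (fun σ => ¬ ∃! C : Finset (Fin (2*k)),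
          IsVertexCover (KonigProc σ ⌈4 * (2*k) * Real.log (2*k)⌉₊) C ∧
          C.card = coverNum (KonigProc σ ⌈4 * (2*k) * Real.log (2*k)⌉₊))
    linarith
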